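/- arXiv:0803.2433 — 3 statements merged into one kernel-verified Lean document; each statement's English description precedes it below -/
import Mathlib

section
/- If G is a 2-degenerate simple graph with maximum degree Δ, then G admits an acyclic edge coloring using at most Δ+1 colors; that is, a'(G) ≤ Δ+1. -/
open SimpleGraph

namespace AEC

variable {V : Type*}

/-- The set of colors appearing (under partial coloring `c`) on colored edges incident
with the vertex `u` (i.e. `F_u`). -/
def colorsAt (G : SimpleGraph V) (c : Sym2 V → Option ℕ) (u : V) : Set ℕ :=
  {γ | ∃ z, G.Adj u z ∧ c s(u, z) = some γ}

/-- `S_ab`: the set of colors appearing on the colored edges incident with `b`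
other than the edge `ab`. -/
def Sset (G : SimpleGraph V) (c : Sym2 V → Option ℕ) (a b : V) : Set ℕ :=
  {γ | ∃ z, G.Adj b z ∧ z ≠ a ∧ c s(b, z) = some γ}

/-- A partial edge coloring (colors are `ℕ`, `none` = uncolored): it may only color
edges of `G`, and colored edges sharing an endpoint receive distinct colors. -/
def ProperPartialColoring (G : SimpleGraph V) (c : Sym2 V → Option ℕ) : Prop :=
  (∀ e, (c e).isSome → e ∈ G.edgeSet) ∧
  ∀ ⦃u v w : V⦄, G.Adj u v → G.Adj u w → v ≠ w → (c s(u, v)).isSome →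
    c s(u, v) ≠ c s(u, w)

/-- A valid (acyclic) partial coloring: proper, and no cycle of `G` is bichromatic,
i.e. no cycle has all of its edges colored using only two colors. -/
def AcyclicPartialColoring (G : SimpleGraph V) (c : Sym2 V → Option ℕ) : Prop :=
  ProperPartialColoring G c ∧
  ∀ (α β : ℕ) (v : V) (W : G.Walk v v), W.IsCycle →
    ¬ ∀ e ∈ W.edges, c e = some α ∨ c e = some β

/-- An acyclic edge coloring of `G` using (at most) `k` colors: a valid partial coloring
that colors every edge of `G` with a color `< k`. -/
def IsAcyclicEdgeColoring (G : SimpleGraph V) (k : ℕ) (c : Sym2 V → Option ℕ) : Prop :=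
  AcyclicPartialColoring G c ∧ ∀ e ∈ G.edgeSet, ∃ a, a < k ∧ c e = some a

/-- `G` is 2-degenerate: every nonempty (induced) subgraph has a vertex of degree at most 2. -/
def TwoDegenerate [DecidableEq V] (G : SimpleGraph V) [DecidableRel G.Adj] : Prop :=
  ∀ s : Finset V, s.Nonempty → ∃ v ∈ s, (s.filter fun u => G.Adj v u).card ≤ 2

/-- A maximal `(α,β)`-bichromatic path from `a` to `b`: a path all of whose edges are
colored `α` or `β`, which cannot be extended at either end. -/
def IsMaximalBichromaticPath (G : SimpleGraph V) (c : Sym2 V → Option ℕ)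
    (α β : ℕ) {a b : V} (W : G.Walk a b) : Prop :=
  W.IsPath ∧ (∀ e ∈ W.edges, c e = some α ∨ c e = some β) ∧
  (∀ w, G.Adj a w → (c s(a, w) = some α ∨ c s(a, w) = some β) → w ∈ W.support) ∧
  (∀ w, G.Adj b w → (c s(b, w) = some α ∨ c s(b, w) = some β) → w ∈ W.support)

/-- An `(α,β,a,b)`-maximal bichromatic path: a maximal `(α,β)`-bichromatic path from
`a` to `b` whose edge incident on `a` is colored `α`. -/
def IsMaxBichromaticPathFrom (G : SimpleGraph V) (c : Sym2 V → Option ℕ)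
    (α β : ℕ) {a b : V} (W : G.Walk a b) : Prop :=
  IsMaximalBichromaticPath G c α β W ∧ ∃ e, W.edges.head? = some e ∧ c e = some α

/-- An `(α,β,ab)`-critical path: a maximal `(α,β)`-bichromatic path from `a` to `b` whose
edges incident on `a` and on `b` are both colored `α`. -/
def IsCriticalPath (G : SimpleGraph V) (c : Sym2 V → Option ℕ)
    (α β : ℕ) {a b : V} (W : G.Walk a b) : Prop :=
  IsMaxBichromaticPathFrom G c α β W ∧ ∃ e, W.edges.getLast? = some e ∧ c e = some α

/-- `F''_x(c)`: colors of edges from `x` to its neighbors (other than `y`) of degree ≥ 3. -/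
def Fpp [Fintype V] (G : SimpleGraph V) [DecidableRel G.Adj]
    (c : Sym2 V → Option ℕ) (x y : V) : Set ℕ :=
  {γ | ∃ z, G.Adj x z ∧ z ≠ y ∧ 3 ≤ G.degree z ∧ c s(x, z) = some γ}

/-- `F'_x(c)`: colors of edges from `x` to its neighbors (other than `y`) of degree 2. -/
def Fp [Fintype V] (G : SimpleGraph V) [DecidableRel G.Adj]
    (c : Sym2 V → Option ℕ) (x y : V) : Set ℕ :=
  {γ | ∃ z, G.Adj x z ∧ z ≠ y ∧ G.degree z = 2 ∧ c s(x, z) = some γ}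

/-- `F_x(c) = F'_x(c) ∪ F''_x(c)`. -/
def Fx [Fintype V] (G : SimpleGraph V) [DecidableRel G.Adj]
    (c : Sym2 V → Option ℕ) (x y : V) : Set ℕ :=
  Fp G c x y ∪ Fpp G c x y

/-- The spanning subgraph formed by the edges that `c` colors `a` or `b`. -/
def twoColorGraph (c : Sym2 V → Option ℕ) (a b : ℕ) : SimpleGraph V where
  Adj u v := u ≠ v ∧ (c s(u, v) = some a ∨ c s(u, v) = some b)
  symm := ⟨fun _ _ h => ⟨h.1.symm, by rw [Sym2.eq_swap]; exact h.2⟩⟩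
  loopless := ⟨fun _ h => h.1 rfl⟩

/-- The color `a` appears at the vertex `u`. -/
def Seen (c : Sym2 V → Option ℕ) (u : V) (a : ℕ) : Prop := ∃ v, c s(u, v) = some a

/-- `c` is an acyclic edge coloring of the graph formed by the edges it colors. -/
structure Valid (c : Sym2 V → Option ℕ) : Prop where
  ne : ∀ ⦃u v : V⦄ ⦃a : ℕ⦄, c s(u, v) = some a → u ≠ v
  proper : ∀ ⦃u v w a⦄, c s(u, v) = some a → c s(u, w) = some a → v = w
  acyclic : ∀ a b, (twoColorGraph c a b).IsAcyclic

/-- `c` is an acyclic edge coloring of `G` with colors less than `k`, coloring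
nothing but the edges of `G`. -/
structure Full (c : Sym2 V → Option ℕ) (G : SimpleGraph V) (k : ℕ) : Prop extends Valid c where
  dom : ∀ u v, G.Adj u v ↔ ∃ a, c s(u, v) = some a
  lt : ∀ ⦃u v a⦄, c s(u, v) = some a → a < k

open Classical in
/-- The coloring obtained from `c` by giving the edge `uv` the color `o`
(or uncoloring it if `o = none`). -/
noncomputable def setColor (c : Sym2 V → Option ℕ) (u v : V) (o : Option ℕ) : Sym2 V → Option ℕ :=
  fun e => if e = s(u, v) then o else c e

lemma setColor_some_iff {c : Sym2 V → Option ℕ} {u v p q : V} {a b : ℕ} :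
    setColor c u v (some a) s(p, q) = some b ↔
      (s(p, q) = s(u, v) ∧ a = b) ∨ (s(p, q) ≠ s(u, v) ∧ c s(p, q) = some b) := by
  unfold setColor; split_ifs with h <;> simp [h]

lemma setColor_none_iff {c : Sym2 V → Option ℕ} {u v p q : V} {b : ℕ} :
    setColor c u v none s(p, q) = some b ↔ s(p, q) ≠ s(u, v) ∧ c s(p, q) = some b := by
  unfold setColor; split_ifs with h <;> simp [h]

lemma color_swap {c : Sym2 V → Option ℕ} {u v : V} {a : ℕ} (h : c s(u, v) = some a) :
    c s(v, u) = some a := by rwa [Sym2.eq_swap]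

lemma Seen.mono {c d : Sym2 V → Option ℕ} (hcd : ∀ u v a, c s(u, v) = some a → d s(u, v) = some a)
    {u : V} {a : ℕ} (h : Seen c u a) : Seen d u a :=
  h.imp fun _ hv => hcd _ _ _ hv

lemma twoColorGraph_comm (c : Sym2 V → Option ℕ) (a b : ℕ) :
    twoColorGraph c a b = twoColorGraph c b a := by
  ext u v; simp [twoColorGraph, or_comm]

lemma twoColorGraph_mono {c d : Sym2 V → Option ℕ}
    (hcd : ∀ u v a, c s(u, v) = some a → d s(u, v) = some a) (a b : ℕ) :
    twoColorGraph c a b ≤ twoColorGraph d a b := fun _ _ h =>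
  ⟨h.1, h.2.imp (hcd _ _ _) (hcd _ _ _)⟩

lemma Valid.mono {c d : Sym2 V → Option ℕ} (hd : Valid d)
    (hcd : ∀ u v a, c s(u, v) = some a → d s(u, v) = some a) : Valid c where
  ne _ _ _ h := hd.ne (hcd _ _ _ h)
  proper _ _ _ _ h h' := hd.proper (hcd _ _ _ h) (hcd _ _ _ h')
  acyclic a b := (hd.acyclic a b).anti (twoColorGraph_mono hcd a b)

lemma not_reachable_of_closed {H : SimpleGraph V} (S : Set V)
    (hS : ∀ u v, u ∈ S → H.Adj u v → v ∈ S) {u v : V} (hu : u ∈ S) (hv : v ∉ S) :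
    ¬ H.Reachable u v := by
  rintro ⟨p⟩
  induction p with
  | nil => exact hv hu
  | cons h _ ih => exact ih (hS _ _ hu h) hv

lemma reachable_map {H H' : SimpleGraph V} (f : V → V)
    (hf : ∀ u v, H.Adj u v → f u = f v ∨ H'.Adj (f u) (f v)) {u v : V} (h : H.Reachable u v) :
    H'.Reachable (f u) (f v) := by
  obtain ⟨p⟩ := h
  induction p with
  | nil => rfl
  | cons h _ ih =>
    rcases hf _ _ h with h | h
    · rwa [h]
    · exact h.reachable.trans ih

/-- A component of a graph of maximum degree two contains at most two leaves. -/
lemma not_reachable_three_leaves {H : SimpleGraph V}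
    (hdeg : ∀ v p q r, H.Adj v p → H.Adj v q → H.Adj v r → p = q ∨ p = r ∨ q = r)
    {u v w : V} (hu : ∀ p q, H.Adj u p → H.Adj u q → p = q)
    (hv : ∀ p q, H.Adj v p → H.Adj v q → p = q) (hw : ∀ p q, H.Adj w p → H.Adj w q → p = q)
    (huv : u ≠ v) (huw : u ≠ w) (hvw : v ≠ w) (h : H.Reachable u v) : ¬ H.Reachable u w := by
  classical
  obtain ⟨p, hp⟩ := h.exists_isPath
  have hlen : 0 < p.length := by
    rcases Nat.eq_zero_or_pos p.length with h0 | h0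
    · exact absurd (Walk.eq_of_length_eq_zero h0) huv
    · exact h0
  have hinner : ∀ i, 0 < i → i < p.length → H.Adj (p.getVert i) (p.getVert (i - 1)) ∧
      H.Adj (p.getVert i) (p.getVert (i + 1)) ∧ p.getVert (i - 1) ≠ p.getVert (i + 1) := by
    intro i hi hil
    refine ⟨?_, p.adj_getVert_succ hil, fun he => ?_⟩
    · have := p.adj_getVert_succ (i := i - 1) (by omega)
      rw [Nat.sub_add_cancel hi] at this
      exact this.symm
    · have := hp.getVert_injOn (by simp; omega) (by simp; omega) he
      omega
  refine not_reachable_of_closed {z | ∃ i ≤ p.length, p.getVert i = z} ?_ ⟨0, by simp⟩ ?_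
  · rintro _ z ⟨i, hi, rfl⟩ hz
    rcases Nat.eq_zero_or_pos i with rfl | h0
    · refine ⟨1, hlen, hu _ _ ?_ (by simpa using hz)⟩
      simpa using p.adj_getVert_succ hlen
    rcases hi.lt_or_eq with hil | rfl
    · obtain ⟨h1, h2, h3⟩ := hinner i h0 hil
      rcases hdeg _ _ _ _ h1 h2 hz with h | h | h
      · exact absurd h h3
      · exact ⟨i - 1, by omega, h⟩
      · exact ⟨i + 1, by omega, h⟩
    · refine ⟨p.length - 1, by omega, hv _ _ ?_ (by simpa using hz)⟩
      have := p.adj_getVert_succ (i := p.length - 1) (by omega)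
      rw [Nat.sub_add_cancel h0, p.getVert_length] at this
      exact this.symm
  · rintro ⟨i, hi, rfl⟩
    rcases Nat.eq_zero_or_pos i with rfl | h0
    · simp at huw
    rcases hi.lt_or_eq with hil | rfl
    · obtain ⟨h1, h2, h3⟩ := hinner i h0 hil
      exact h3 (hw _ _ h1 h2)
    · simp at hvw

lemma twoColorGraph_leaf {c : Sym2 V → Option ℕ} (hc : Valid c) {a b : ℕ} {u : V}
    (hu : ¬ Seen c u a ∨ ¬ Seen c u b) (p q : V) (hp : (twoColorGraph c a b).Adj u p)
    (hq : (twoColorGraph c a b).Adj u q) : p = q := by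
  rcases hp.2 with hp | hp <;> rcases hq.2 with hq | hq
  · exact hc.proper hp hq
  · rcases hu with hu | hu
    · exact absurd ⟨_, hp⟩ hu
    · exact absurd ⟨_, hq⟩ hu
  · rcases hu with hu | hu
    · exact absurd ⟨_, hq⟩ hu
    · exact absurd ⟨_, hp⟩ hu
  · exact hc.proper hp hq

lemma Valid.not_reachable_three {c : Sym2 V → Option ℕ} (hc : Valid c) {a b : ℕ} {u v w : V}
    (hu : ¬ Seen c u a ∨ ¬ Seen c u b) (hv : ¬ Seen c v a ∨ ¬ Seen c v b)
    (hw : ¬ Seen c w a ∨ ¬ Seen c w b) (huv : u ≠ v) (huw : u ≠ w) (hvw : v ≠ w)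
    (h : (twoColorGraph c a b).Reachable u v) : ¬ (twoColorGraph c a b).Reachable u w := by
  refine not_reachable_three_leaves ?_ (twoColorGraph_leaf hc hu) (twoColorGraph_leaf hc hv)
    (twoColorGraph_leaf hc hw) huv huw hvw h
  rintro z p q r ⟨-, hp⟩ ⟨-, hq⟩ ⟨-, hr⟩
  rcases hp with hp | hp <;> rcases hq with hq | hq <;> rcases hr with hr | hr <;>
    first
    | exact Or.inl (hc.proper hp hq)
    | exact Or.inr (Or.inl (hc.proper hp hr))
    | exact Or.inr (Or.inr (hc.proper hq hr))

lemma not_reachable_of_not_seen {c : Sym2 V → Option ℕ} {a b : ℕ} {u v : V}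
    (ha : ¬ Seen c u a) (hb : ¬ Seen c u b) (huv : u ≠ v) :
    ¬ (twoColorGraph c a b).Reachable u v := by
  refine not_reachable_of_closed {u} ?_ rfl huv.symm
  rintro _ w rfl ⟨-, h | h⟩
  · exact absurd ⟨_, h⟩ ha
  · exact absurd ⟨_, h⟩ hb

/-- If `u` sees `a` only through the edge `us` and does not see `b`, and `s` does not see `b`,
then the `(a, b)`-component of `u` is `{u, s}`. -/
lemma not_reachable_of_edge {c : Sym2 V → Option ℕ} (hc : Valid c) {a b : ℕ} {u s v : V}
    (hus : c s(u, s) = some a) (hu : ¬ Seen c u b) (hs : ¬ Seen c s b) (huv : v ≠ u)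
    (hsv : v ≠ s) : ¬ (twoColorGraph c a b).Reachable u v := by
  refine not_reachable_of_closed {u, s} ?_ (by simp) (by simp [huv, hsv])
  rintro z w (rfl | rfl) ⟨-, h | h⟩
  · exact Or.inr (hc.proper h hus)
  · exact absurd ⟨_, h⟩ hu
  · exact Or.inl (hc.proper h (color_swap hus))
  · exact absurd ⟨_, h⟩ hs

lemma Valid.setColor_some {c : Sym2 V → Option ℕ} (hc : Valid c) {u v : V} {g : ℕ} (huv : u ≠ v)
    (hu : ¬ Seen c u g) (hv : ¬ Seen c v g)
    (h : ∀ b, b ≠ g → ¬ (twoColorGraph c g b).Reachable u v) :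
    Valid (setColor c u v (some g)) := by
  have key : ∀ b, (twoColorGraph (setColor c u v (some g)) g b).IsAcyclic := by
    intro b
    have h1 : (twoColorGraph c g b ⊔ edge u v).IsAcyclic := by
      refine (hc.acyclic g b).sup_edge_of_not_reachable ?_
      by_cases hb : b = g
      · subst hb; exact not_reachable_of_not_seen hu hu huv
      · exact h b hb
    refine h1.anti fun p q hpq => ?_
    by_cases he : s(p, q) = s(u, v)
    · right
      rw [edge_adj]
      exact ⟨by simpa using he, hpq.1⟩
    · left
      refine ⟨hpq.1, ?_⟩
      have := hpq.2
      simpa [setColor_some_iff, he] using this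
  refine ⟨?_, ?_, ?_⟩
  · intro p q a hpq
    rcases setColor_some_iff.1 hpq with ⟨h1, -⟩ | ⟨-, h1⟩
    · rintro rfl; rw [Sym2.eq_iff] at h1; grind
    · exact hc.ne h1
  · intro p q r a hq hr
    rcases setColor_some_iff.1 hq with ⟨h1, rfl⟩ | ⟨h0, h1⟩ <;>
      rcases setColor_some_iff.1 hr with ⟨h2, h3⟩ | ⟨h3, h2⟩
    · simp only [Sym2.eq_iff] at h1 h2; grind
    · rcases Sym2.eq_iff.1 h1 with ⟨rfl, rfl⟩ | ⟨rfl, rfl⟩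
      · exact absurd ⟨_, h2⟩ hu
      · exact absurd ⟨_, h2⟩ hv
    · subst h3
      rcases Sym2.eq_iff.1 h2 with ⟨rfl, rfl⟩ | ⟨rfl, rfl⟩
      · exact absurd ⟨_, h1⟩ hu
      · exact absurd ⟨_, h1⟩ hv
    · exact hc.proper h1 h2
  · intro a b
    by_cases ha : a = g
    · subst ha; exact key b
    by_cases hb : b = g
    · subst hb; rw [twoColorGraph_comm]; exact key a
    refine (hc.acyclic a b).anti fun p q hpq => ?_
    refine ⟨hpq.1, ?_⟩
    refine hpq.2.imp (fun h => ?_) (fun h => ?_)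
    · rcases setColor_some_iff.1 h with ⟨-, h1⟩ | ⟨-, h1⟩
      · exact absurd h1.symm ha
      · exact h1
    · rcases setColor_some_iff.1 h with ⟨-, h1⟩ | ⟨-, h1⟩
      · exact absurd h1.symm hb
      · exact h1

/-- The graph obtained from `G` by isolating the vertices of `S`. -/
def isolate (G : SimpleGraph V) (S : Set V) : SimpleGraph V where
  Adj u v := G.Adj u v ∧ u ∉ S ∧ v ∉ S
  symm := ⟨fun _ _ h => ⟨h.1.symm, h.2.2, h.2.1⟩⟩
  loopless := ⟨fun _ h => h.1.ne rfl⟩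

lemma isolate_le (G : SimpleGraph V) (S : Set V) : isolate G S ≤ G := fun _ _ h => h.1

lemma isolate_lt {G : SimpleGraph V} {S : Set V} {u v : V} (h : G.Adj u v) (hu : u ∈ S) :
    isolate G S < G :=
  lt_of_le_of_ne (isolate_le G S) fun he => by
    rw [← he] at h; exact h.2.1 hu

lemma isolate_empty (G : SimpleGraph V) : isolate G ∅ = G := by
  ext u v; simp [isolate]

lemma Full.adj {c : Sym2 V → Option ℕ} {G : SimpleGraph V} {k : ℕ} (hc : Full c G k) {u v : V}
    {a : ℕ} (h : c s(u, v) = some a) : G.Adj u v := (hc.dom u v).2 ⟨a, h⟩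

lemma Full.not_seen_of_mem {c : Sym2 V → Option ℕ} {G : SimpleGraph V} {S : Set V} {k : ℕ}
    (hc : Full c (isolate G S) k) {u : V} (hu : u ∈ S) (a : ℕ) : ¬ Seen c u a := by
  rintro ⟨v, hv⟩
  exact (hc.adj hv).2.1 hu

lemma Full.mk_setColor {c : Sym2 V → Option ℕ} {G G' : SimpleGraph V} {k : ℕ} (hc : Full c G' k)
    {u v : V} {g : ℕ} (hg : g < k)
    (hv : Valid (setColor c u v (some g)))
    (hG : ∀ p q, G.Adj p q ↔ G'.Adj p q ∨ s(p, q) = s(u, v)) :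
    Full (setColor c u v (some g)) G k where
  toValid := hv
  dom p q := by
    rw [hG, hc.dom]
    simp only [setColor_some_iff]
    by_cases he : s(p, q) = s(u, v)
    · simp [he]
    · simp [he]
  lt p q a h := by
    rcases setColor_some_iff.1 h with ⟨-, rfl⟩ | ⟨-, h⟩
    · exact hg
    · exact hc.lt h

/-- The degree of `v` in `G`. -/
noncomputable def deg (G : SimpleGraph V) (v : V) : ℕ := (G.neighborSet v).ncard

lemma exists_adj_of_deg_eq_two {G : SimpleGraph V} {y x : V} (h : deg G y = 2) (hyx : G.Adj y x) :
    ∃ y', y' ≠ x ∧ ∀ v, G.Adj y v ↔ v = x ∨ v = y' := by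
  obtain ⟨p, q, hpq, he⟩ := Set.ncard_eq_two.1 h
  have hadj : ∀ v, G.Adj y v ↔ v = p ∨ v = q := fun v => by
    rw [← mem_neighborSet, he]; simp
  rcases (hadj x).1 hyx with rfl | rfl
  · exact ⟨q, hpq.symm, hadj⟩
  · exact ⟨p, hpq, fun v => (hadj v).trans or_comm⟩

section Finite

variable [Finite V]

lemma card_le_of_seen {c : Sym2 V → Option ℕ} {x : V} (T : Finset ℕ) (A : Set V)
    (hT : ∀ a ∈ T, ∃ v ∈ A, c s(x, v) = some a) : T.card ≤ A.ncard := by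
  have : Nonempty V := ⟨x⟩
  choose! f hf using hT
  rw [← Set.ncard_coe_finset]
  refine Set.ncard_le_ncard_of_injOn f (fun a ha => (hf a ha).1) ?_ (Set.toFinite _)
  intro a ha b hb hab
  have h1 := (hf a ha).2
  have h2 := (hf b hb).2
  rw [hab, h2] at h1
  exact (Option.some.inj h1).symm

lemma Full.exists_not_seen {c : Sym2 V → Option ℕ} {G G' : SimpleGraph V} {D : ℕ}
    (hc : Full c G' (D + 1)) (hle : G' ≤ G) {x : V} (hx : deg G x ≤ D) :
    ∃ a < D + 1, ¬ Seen c x a := by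
  by_contra! h
  have := card_le_of_seen (c := c) (x := x) (Finset.range (D + 1)) (G.neighborSet x) (by
    intro a ha
    obtain ⟨v, hv⟩ := h a (Finset.mem_range.1 ha)
    exact ⟨v, hle (hc.adj hv), hv⟩)
  rw [Finset.card_range] at this
  unfold deg at hx
  omega

lemma Full.exists_ne_not_seen {c : Sym2 V → Option ℕ} {G G' : SimpleGraph V} {D : ℕ}
    (hc : Full c G' (D + 1)) (hle : G' ≤ G) {x y : V} (hx : deg G x ≤ D) (hxy : G.Adj x y)
    (hxy' : ¬ G'.Adj x y) (p : ℕ) : ∃ a < D + 1, a ≠ p ∧ ¬ Seen c x a := by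
  by_contra! h
  have h1 := card_le_of_seen (c := c) (x := x) ((Finset.range (D + 1)).erase p)
    (G.neighborSet x \ {y}) (by
    intro a ha
    rw [Finset.mem_erase, Finset.mem_range] at ha
    obtain ⟨v, hv⟩ := h a ha.2 ha.1
    refine ⟨v, ⟨hle (hc.adj hv), ?_⟩, hv⟩
    rintro rfl
    exact hxy' (hc.adj hv))
  have h2 := Finset.pred_card_le_card_erase (s := Finset.range (D + 1)) (a := p)
  rw [Finset.card_range] at h2
  have h3 := Set.ncard_sdiff_singleton_add_one (s := G.neighborSet x) (a := y) hxy
  unfold deg at hx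
  omega

end Finite

lemma Full.recolor {c : Sym2 V → Option ℕ} {G : SimpleGraph V} {k : ℕ} (hc : Full c G k) {u v : V}
    (huv : G.Adj u v) {g : ℕ} (hg : g < k)
    (hv : Valid (setColor (setColor c u v none) u v (some g))) :
    Full (setColor (setColor c u v none) u v (some g)) G k where
  toValid := hv
  dom p q := by
    simp only [setColor_some_iff, setColor_none_iff]
    by_cases he : s(p, q) = s(u, v)
    · have : G.Adj p q := by
        rcases Sym2.eq_iff.1 he with ⟨rfl, rfl⟩ | ⟨rfl, rfl⟩
        · exact huv
        · exact huv.symm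
      simp [he, this]
    · simp [he, hc.dom]
  lt p q a h := by
    rcases setColor_some_iff.1 h with ⟨-, rfl⟩ | ⟨h0, h⟩
    · exact hg
    · exact hc.lt (setColor_none_iff.1 h).2

/-- Coloring a path `x y y'` through an uncolored vertex `y`. -/
lemma Full.extend_through {c : Sym2 V → Option ℕ} {G : SimpleGraph V} {k : ℕ} {S : Set V}
    (hc : Full c (isolate G S) k) {x y y' : V} (hyS : y ∈ S) (hxS : x ∉ S) (hy'S : y' ∉ S)
    (hxy' : y' ≠ x) (hy : ∀ v, G.Adj y v ↔ v = x ∨ v = y') {d g : ℕ} (hd : d < k) (hg : g < k)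
    (hdg : g ≠ d) (hdy' : ¬ Seen c y' d) (hgx : ¬ Seen c x g)
    (hr : ¬ (twoColorGraph c d g).Reachable x y') :
    Full (setColor (setColor c y y' (some d)) x y (some g)) (isolate G (S \ {y})) k := by
  have hyx : y ≠ x := by rintro rfl; exact hxS hyS
  have hyy' : y ≠ y' := by rintro rfl; exact hy'S hyS
  have hny := hc.not_seen_of_mem hyS
  have h1 : Valid (setColor c y y' (some d)) := by
    refine hc.setColor_some hyy' (hny d) hdy' fun b _ => ?_
    exact not_reachable_of_not_seen (hny _) (hny _) hyy'
  have h2 : Valid (setColor (setColor c y y' (some d)) x y (some g)) := by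
    have hyseen : ∀ v a, setColor c y y' (some d) s(y, v) = some a → v = y' ∧ a = d := by
      intro v a hv
      rcases setColor_some_iff.1 hv with ⟨h, rfl⟩ | ⟨-, h⟩
      · rw [Sym2.eq_iff] at h; grind
      · exact absurd ⟨_, h⟩ (hny a)
    have hold : ∀ u v a, u ≠ y → v ≠ y → setColor c y y' (some d) s(u, v) = some a →
        c s(u, v) = some a := by
      intro u v a hu hv h
      rcases setColor_some_iff.1 h with ⟨h', rfl⟩ | ⟨-, h⟩
      · rw [Sym2.eq_iff] at h'; grind
      · exact h
    refine h1.setColor_some hyx.symm ?_ ?_ fun b hb => ?_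
    · rintro ⟨v, hv⟩
      by_cases hvy : v = y
      · subst hvy
        exact hxy' (hyseen _ _ (color_swap hv)).1.symm
      · exact hgx ⟨v, hold _ _ _ hyx.symm hvy hv⟩
    · rintro ⟨v, hv⟩
      exact hdg (hyseen _ _ hv).2
    · by_cases hbd : b = d
      · subst hbd
        classical
        intro hreach
        apply hr
        have := reachable_map (H' := twoColorGraph c b g) (fun z => if z = y then y' else z) ?_
          hreach
        · simpa [hyx.symm] using this
        · rintro u v ⟨huv, h⟩
          rw [or_comm] at h
          by_cases hu : u = y
          · subst hu
            have : v = y' := by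
              rcases h with h | h <;> exact (hyseen _ _ h).1
            subst this
            simp [hyy'.symm]
          by_cases hv : v = y
          · subst hv
            have : u = y' := by
              rcases h with h | h <;> exact (hyseen _ _ (color_swap h)).1
            subst this
            simp [hu]
          · right
            simp only [hu, hv, if_false]
            exact ⟨huv, h.imp (hold _ _ _ hu hv) (hold _ _ _ hu hv)⟩
      · intro hreach
        refine not_reachable_of_not_seen ?_ ?_ hyx hreach.symm
        · rintro ⟨v, hv⟩; exact hdg (hyseen _ _ hv).2
        · rintro ⟨v, hv⟩; exact hbd (hyseen _ _ hv).2
  have h3 : Full (setColor c y y' (some d)) (isolate G S ⊔ edge y y') k := by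
    refine hc.mk_setColor hd h1 fun p q => ?_
    rw [sup_adj, edge_adj, Sym2.eq_iff]
    have := fun h : (isolate G S).Adj p q => h.1.ne
    grind
  refine h3.mk_setColor hg h2 fun p q => ?_
  rw [sup_adj, edge_adj, Sym2.eq_iff]
  have hx : G.Adj y x := (hy x).2 (Or.inl rfl)
  have hy2 : G.Adj y y' := (hy y').2 (Or.inr rfl)
  simp only [isolate, Set.mem_sdiff, Set.mem_singleton_iff]
  constructor
  · rintro ⟨h, hp, hq⟩
    by_cases hpy : p = y
    · subst hpy
      rcases (hy q).1 h with rfl | rfl <;> grind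
    by_cases hqy : q = y
    · subst hqy
      rcases (hy p).1 h.symm with rfl | rfl <;> grind
    · grind
  · have := hx.symm
    have := hy2.symm
    grind

/-- `x` has exactly two neighbors `z₁`, `z₂` that do not have degree two. -/
structure Pivot (G : SimpleGraph V) (x z₁ z₂ : V) : Prop where
  ne : z₁ ≠ z₂
  adj₁ : G.Adj x z₁
  adj₂ : G.Adj x z₂
  three_le₁ : 3 ≤ deg G z₁
  three_le₂ : 3 ≤ deg G z₂
  deg_eq_two : ∀ v, G.Adj x v → v ≠ z₁ → v ≠ z₂ → deg G v = 2

lemma Pivot.symm {x z₁ z₂ : V} (h : Pivot G x z₁ z₂) : Pivot G x z₂ z₁ :=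
  ⟨h.ne.symm, h.adj₂, h.adj₁, h.three_le₂, h.three_le₁, fun v hv h2 h1 => h.deg_eq_two v hv h1 h2⟩

/-- The neighbors of `x` of degree two. -/
def smallNeighbors (G : SimpleGraph V) (x : V) : Set V := {v | G.Adj x v ∧ deg G v = 2}

/-- With respect to a coloring `c` of the graph without the small neighbors of `x`, the small
neighbor `y` of `x`, whose other neighbor is `y'`, cannot be colored next to an edge at `x`
colored `a`. -/
structure Blocked (c : Sym2 V → Option ℕ) (k : ℕ) (x y' : V) (a b : ℕ) : Prop where
  not_seen : ¬ Seen c y' a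
  reachable : ∀ g < k, g ≠ a → g ≠ b → (twoColorGraph c a g).Reachable x y'

/-- The vertex `v` misses the colors `a` and `a'`, and it is joined to `z₁` by `a`-bichromatic
paths and to `z₂` by `a'`-bichromatic paths for all other colors. -/
structure Linked (c : Sym2 V → Option ℕ) (k : ℕ) (z₁ z₂ v : V) (a a' : ℕ) : Prop where
  ne₁ : v ≠ z₁
  ne₂ : v ≠ z₂
  not_seen₁ : ¬ Seen c v a
  not_seen₂ : ¬ Seen c v a'
  reachable₁ : ∀ g < k, g ≠ a → g ≠ a' → (twoColorGraph c a g).Reachable z₁ v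
  reachable₂ : ∀ g < k, g ≠ a → g ≠ a' → (twoColorGraph c a' g).Reachable z₂ v

lemma reachable_of_pendant {c b : Sym2 V → Option ℕ} {x z v : V}
    (hcb : ∀ u v e, u ≠ x → v ≠ x → c s(u, v) = some e → b s(u, v) = some e) {a g : ℕ}
    (hx : ∀ w, (twoColorGraph c a g).Adj x w → w = z) (hzx : z ≠ x) (hvx : v ≠ x)
    (h : (twoColorGraph c a g).Reachable x v) : (twoColorGraph b a g).Reachable z v := by
  classical
  have := reachable_map (H' := twoColorGraph b a g) (fun w => if w = x then z else w) ?_ h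
  · simpa [hvx] using this
  · intro p q hpq
    by_cases hpx : p = x
    · subst hpx
      have := hx q hpq
      subst this
      simp [hzx]
    by_cases hqx : q = x
    · subst hqx
      have := hx p hpq.symm
      subst this
      simp [hpx]
    · right
      simp only [hpx, hqx, if_false]
      exact ⟨hpq.1, hpq.2.imp (hcb _ _ _ hpx hqx) (hcb _ _ _ hpx hqx)⟩

lemma Linked.seen {c : Sym2 V → Option ℕ} {k : ℕ} {z₁ z₂ v : V} {a a' : ℕ}
    (hl : Linked c k z₁ z₂ v a a') (h1 : ¬ Seen c z₁ a) {g : ℕ} (hg : g < k) (hga : g ≠ a)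
    (hga' : g ≠ a') : Seen c z₁ g := by
  by_contra hs
  exact not_reachable_of_not_seen h1 hs hl.ne₁.symm (hl.reachable₁ g hg hga hga')

section Critical

variable [Finite V]

lemma Full.exists_unique_other_color {c : Sym2 V → Option ℕ} {G G' : SimpleGraph V} {k : ℕ}
    (hc : Full c G' k) (hle : G' ≤ G) {s x : V} (hs : deg G s ≤ 2) (hsx : G.Adj s x) :
    ∃ e, ∀ v a, v ≠ x → c s(s, v) = some a → a = e := by
  by_cases h : ∃ v a, v ≠ x ∧ c s(s, v) = some a
  · obtain ⟨v, e, hvx, hv⟩ := h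
    refine ⟨e, fun w a hwx hw => ?_⟩
    have h1 := Set.ncard_sdiff_singleton_add_one (s := G.neighborSet s) (a := x) hsx
    have h2 : (G.neighborSet s \ {x}).ncard ≤ 1 := by unfold deg at hs; omega
    have h3 := (Set.ncard_le_one (Set.toFinite _)).1 h2 v ⟨hle (hc.adj hv), hvx⟩
      w ⟨hle (hc.adj hw), hwx⟩
    subst h3
    rw [hv] at hw
    exact (Option.some.inj hw).symm
  · push Not at h
    exact ⟨0, fun v a hvx hv => absurd hv (h v a hvx)⟩

/-- If the path `x y y'` cannot be colored, then every color missing at `y'` is the color of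
an edge from `x` to a vertex of degree at least three. -/
lemma Full.exists_large_of_not_extend {c : Sym2 V → Option ℕ} {G : SimpleGraph V} {D : ℕ}
    {S : Set V} (hdeg : ∀ v, deg G v ≤ D)
    (hc : Full c (isolate G S) (D + 1)) {x y y' : V} (hyS : y ∈ S) (hxS : x ∉ S) (hy'S : y' ∉ S)
    (hxy' : y' ≠ x) (hy : ∀ v, G.Adj y v ↔ v = x ∨ v = y')
    (hno : ∀ d g, ¬ Full (setColor (setColor c y y' (some d)) x y (some g))
      (isolate G (S \ {y})) (D + 1))
    {d : ℕ} (hd : d < D + 1) (hdy' : ¬ Seen c y' d) :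
    ∃ s, c s(x, s) = some d ∧ 3 ≤ deg G s := by
  have hfree : ∀ p, ∃ g < D + 1, g ≠ p ∧ ¬ Seen c x g :=
    hc.exists_ne_not_seen (isolate_le G S) (hdeg x) ((hy x).2 (Or.inl rfl)).symm
      (fun h => h.2.2 hyS)
  by_cases hdx : Seen c x d
  · obtain ⟨s, hs⟩ := hdx
    refine ⟨s, hs, ?_⟩
    by_contra! hlt
    have hxs : G.Adj x s := (hc.adj hs).1
    obtain ⟨e, he⟩ := hc.exists_unique_other_color (isolate_le G S) (Nat.le_of_lt_succ hlt) hxs.symm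
    obtain ⟨g, hg, hge, hgx⟩ := hfree e
    have hsg : ¬ Seen c s g := by
      rintro ⟨v, hv⟩
      by_cases hvx : v = x
      · subst hvx
        exact hgx ⟨_, color_swap hv⟩
      · exact hge (he v g hvx hv)
    refine hno d g (hc.extend_through hyS hxS hy'S hxy' hy hd hg ?_ hdy' hgx ?_)
    · rintro rfl; exact hgx ⟨_, hs⟩
    · refine not_reachable_of_edge hc.toValid hs hgx hsg hxy' ?_
      rintro rfl
      exact hdy' ⟨_, color_swap hs⟩
  · obtain ⟨g, hg, hgd, hgx⟩ := hfree d
    exact absurd (hc.extend_through hyS hxS hy'S hxy' hy hd hg hgd hdy' hgx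
      (not_reachable_of_not_seen hdx hgx hxy'.symm)) (hno d g)

/-- `G` is a minimal graph of maximum degree at most `D` without an acyclic edge coloring
with `D + 1` colors. -/
structure Critical (G : SimpleGraph V) (D : ℕ) : Prop where
  deg_le : ∀ v, deg G v ≤ D
  not_colorable : ¬ ∃ c, Full c G (D + 1)
  colorable_of_lt : ∀ G' < G, ∃ c, Full c G' (D + 1)

variable {G : SimpleGraph V} {D : ℕ}

lemma Critical.deg_ne_one (h : Critical G D) (v : V) : deg G v ≠ 1 := by
  intro hv
  obtain ⟨u, hu⟩ := Set.ncard_eq_one.1 hv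
  have hadj : ∀ w, G.Adj v w ↔ w = u := fun w => by rw [← mem_neighborSet, hu]; simp
  have hvu : G.Adj v u := (hadj u).2 rfl
  obtain ⟨c, hc⟩ := h.colorable_of_lt (isolate G {v}) (isolate_lt hvu rfl)
  obtain ⟨g, hg, hgu⟩ := hc.exists_not_seen (isolate_le _ _) (h.deg_le u)
  have hnv := hc.not_seen_of_mem (Set.mem_singleton v)
  refine h.not_colorable ⟨_, hc.mk_setColor hg (hc.setColor_some hvu.ne (hnv g) hgu fun b _ =>
    not_reachable_of_not_seen (hnv _) (hnv _) hvu.ne) fun p q => ?_⟩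
  simp only [isolate, Set.mem_singleton_iff, Sym2.eq_iff]
  have h1 := hadj p
  have h2 := hadj q
  have h3 := G.adj_comm p q
  grind

lemma Critical.exists_two_large (h : Critical G D) {x y : V} (hy : deg G y = 2)
    (hyx : G.Adj y x) :
    ∃ s₁ s₂, s₁ ≠ s₂ ∧ G.Adj x s₁ ∧ G.Adj x s₂ ∧ 3 ≤ deg G s₁ ∧ 3 ≤ deg G s₂ := by
  obtain ⟨y', hy'x, hadj⟩ := exists_adj_of_deg_eq_two hy hyx
  have hyy' : G.Adj y y' := (hadj y').2 (Or.inr rfl)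
  obtain ⟨c, hc⟩ := h.colorable_of_lt (isolate G {y}) (isolate_lt hyx rfl)
  have hfree := hc.exists_ne_not_seen (isolate_le G _) (h.deg_le y') hyy'.symm (fun h => h.2.2 rfl)
  have key : ∀ d < D + 1, ¬ Seen c y' d → ∃ s, c s(x, s) = some d ∧ 3 ≤ deg G s := by
    intro d hd hdy'
    refine hc.exists_large_of_not_extend h.deg_le (Set.mem_singleton y) hyx.ne' hyy'.ne' hy'x hadj
      ?_ hd hdy'
    intro d g hf
    rw [sdiff_self, Set.bot_eq_empty, isolate_empty] at hf
    exact h.not_colorable ⟨_, hf⟩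
  obtain ⟨d, hd, -, hdy⟩ := hfree 0
  obtain ⟨e, he, hed, hey⟩ := hfree d
  obtain ⟨s, hs, hs3⟩ := key d hd hdy
  obtain ⟨t, ht, ht3⟩ := key e he hey
  refine ⟨s, t, ?_, (hc.adj hs).1, (hc.adj ht).1, hs3, ht3⟩
  rintro rfl
  rw [hs] at ht
  exact hed (Option.some.inj ht).symm

lemma Critical.not_adj_of_deg_eq_two (h : Critical G D) {x y : V} (hx : deg G x = 2)
    (hy : deg G y = 2) : ¬ G.Adj x y := by
  intro hxy
  obtain ⟨s, t, hst, hs, ht, hs3, ht3⟩ := h.exists_two_large hy hxy.symm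
  obtain ⟨x', -, hadj⟩ := exists_adj_of_deg_eq_two hx hxy
  rcases (hadj s).1 hs with rfl | rfl
  · omega
  rcases (hadj t).1 ht with rfl | rfl
  · omega
  exact hst rfl

lemma Critical.exists_extend (h : Critical G D) {x z₁ z₂ : V} (hp : Pivot G x z₁ z₂)
    {c₀ : Sym2 V → Option ℕ} (hc₀ : Full c₀ (isolate G (smallNeighbors G x)) (D + 1)) {a b : ℕ}
    (ha : c₀ s(x, z₁) = some a) (hb : c₀ s(x, z₂) = some b)
    {S : Set V} (hS : S ⊆ smallNeighbors G x) {y y' : V} (hyS : y ∈ S) (hy'x : y' ≠ x)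
    (hadj : ∀ v, G.Adj y v ↔ v = x ∨ v = y')
    (hblock : ¬ (Blocked c₀ (D + 1) x y' a b ∧ Blocked c₀ (D + 1) x y' b a))
    {c : Sym2 V → Option ℕ} (hc : Full c (isolate G S) (D + 1))
    (hext : ∀ u v a, c₀ s(u, v) = some a → c s(u, v) = some a) :
    ∃ c', Full c' (isolate G (S \ {y})) (D + 1) ∧
      ∀ u v a, c₀ s(u, v) = some a → c' s(u, v) = some a := by
  classical
  by_contra! hno
  have hxN : x ∉ smallNeighbors G x := fun hx => hx.1.ne rfl
  have hNN : ∀ u v, u ∈ smallNeighbors G x → v ∈ smallNeighbors G x → ¬ G.Adj u v :=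
    fun u v hu hv => h.not_adj_of_deg_eq_two hu.2 hv.2
  have hyN := hS hyS
  have hyy' : G.Adj y y' := (hadj y').2 (Or.inr rfl)
  have hxy : G.Adj x y := hyN.1
  have hy'N : y' ∉ smallNeighbors G x := fun h' => hNN _ _ hyN h' hyy'
  have hnext : ∀ c, Full c (isolate G S) (D + 1) →
      (∀ u v a, c₀ s(u, v) = some a → c s(u, v) = some a) → ∀ d g,
      ¬ Full (setColor (setColor c y y' (some d)) x y (some g)) (isolate G (S \ {y})) (D + 1) := by
    intro c hc hext d g hf
    obtain ⟨u, v, e, he, hne⟩ := hno _ hf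
    apply hne
    have hu : u ≠ y := by rintro rfl; exact hc₀.not_seen_of_mem hyN e ⟨_, he⟩
    have hv : v ≠ y := by rintro rfl; exact hc₀.not_seen_of_mem hyN e ⟨_, color_swap he⟩
    simp only [setColor_some_iff, ne_eq, Sym2.eq_iff]
    have := hext _ _ _ he
    grind
  have hlarge : ∀ v, G.Adj x v → 3 ≤ deg G v → v = z₁ ∨ v = z₂ := by
    intro v hv h3
    by_contra! hv'
    have := hp.deg_eq_two v hv hv'.1 hv'.2
    omega
  have hzN₁ : z₁ ∉ smallNeighbors G x := fun h' => by have := h'.2; have := hp.three_le₁; omega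
  have hzN₂ : z₂ ∉ smallNeighbors G x := fun h' => by have := h'.2; have := hp.three_le₂; omega
  have hmiss : ∀ c, Full c (isolate G S) (D + 1) →
      (∀ u v a, c₀ s(u, v) = some a → c s(u, v) = some a) → ¬ Seen c y' a ∧ ¬ Seen c y' b := by
    intro c hc hext
    have hall : ∀ d < D + 1, ¬ Seen c y' d → d = a ∨ d = b := by
      intro d hd hdy
      obtain ⟨s, hs, hs3⟩ := hc.exists_large_of_not_extend h.deg_le hyS (fun h' => hxN (hS h'))
        (fun h' => hy'N (hS h')) hy'x hadj (hnext c hc hext) hd hdy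
      rcases hlarge s (hc.adj hs).1 hs3 with rfl | rfl
      · rw [hext _ _ _ ha] at hs
        exact Or.inl (Option.some.inj hs).symm
      · rw [hext _ _ _ hb] at hs
        exact Or.inr (Option.some.inj hs).symm
    have hfree := hc.exists_ne_not_seen (isolate_le G _) (h.deg_le y') hyy'.symm
      (fun h => h.2.2 hyS)
    obtain ⟨d, hd, hdb, hdy⟩ := hfree b
    obtain ⟨e, he, hea, hey⟩ := hfree a
    exact ⟨by rwa [(hall d hd hdy).resolve_right hdb] at hdy,
      by rwa [(hall e he hey).resolve_left hea] at hey⟩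
  have hreach : ∀ c, Full c (isolate G S) (D + 1) →
      (∀ u v a, c₀ s(u, v) = some a → c s(u, v) = some a) → ∀ i, i = a ∨ i = b → ∀ g < D + 1,
      ¬ Seen c x g → (twoColorGraph c i g).Reachable x y' := by
    intro c hc hext i hi g hg hgx
    by_contra hr
    have hix : Seen c x i := by
      rcases hi with rfl | rfl
      · exact ⟨_, hext _ _ _ ha⟩
      · exact ⟨_, hext _ _ _ hb⟩
    refine hnext c hc hext i g (hc.extend_through hyS (fun h' => hxN (hS h'))
        (fun h' => hy'N (hS h')) hy'x hadj ?_ hg ?_ ?_ hgx hr)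
    · obtain ⟨v, hv⟩ := hix; exact hc.lt hv
    · rintro rfl; exact hgx hix
    · rcases hi with rfl | rfl
      · exact (hmiss c hc hext).1
      · exact (hmiss c hc hext).2
  have : Nonempty V := ⟨x⟩
  have hother : ∀ t ∈ smallNeighbors G x, ∃ t', t' ≠ x ∧ ∀ v, G.Adj t v ↔ v = x ∨ v = t' :=
    fun t ht => exists_adj_of_deg_eq_two ht.2 ht.1.symm
  choose! o hox hoadj using hother
  have hoN : ∀ t ∈ smallNeighbors G x, o t ∉ smallNeighbors G x := fun t ht h' =>
    hNN _ _ ht h' ((hoadj t ht _).2 (Or.inr rfl))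
  have hproj : ∀ c, Full c (isolate G S) (D + 1) →
      (∀ u v a, c₀ s(u, v) = some a → c s(u, v) = some a) → ∀ i, i = a ∨ i = b → ∀ g < D + 1,
      ¬ Seen c x g → (twoColorGraph c₀ i g).Reachable x y' := by
    intro c hc hext i hi g hg hgx
    have hxt : ∀ t ∈ smallNeighbors G x, c s(t, x) ≠ some i ∧ c s(t, x) ≠ some g := by
      intro t ht
      refine ⟨fun h' => ?_, fun h' => hgx ⟨_, color_swap h'⟩⟩
      rcases hi with rfl | rfl
      · rw [hc.proper (color_swap h') (hext _ _ _ ha)] at ht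
        exact hzN₁ ht
      · rw [hc.proper (color_swap h') (hext _ _ _ hb)] at ht
        exact hzN₂ ht
    have hedge : ∀ t ∈ smallNeighbors G x, ∀ v, (twoColorGraph c i g).Adj t v → v = o t := by
      rintro t ht v ⟨-, h'⟩
      have hadj' : G.Adj t v := by rcases h' with h' | h' <;> exact (hc.adj h').1
      refine ((hoadj t ht v).1 hadj').resolve_left ?_
      rintro rfl
      exact h'.elim (hxt t ht).1 (hxt t ht).2
    have := reachable_map (H' := twoColorGraph c₀ i g)
      (fun z => if z ∈ smallNeighbors G x then o z else z) ?_ (hreach c hc hext i hi g hg hgx)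
    · simpa [hxN, hy'N] using this
    · intro u v huv
      by_cases hu : u ∈ smallNeighbors G x
      · have := hedge u hu v huv
        subst this
        simp [hu, hoN u hu]
      by_cases hv : v ∈ smallNeighbors G x
      · have := hedge v hv u huv.symm
        subst this
        simp [hv, hu]
      right
      simp only [hu, hv, if_false]
      refine ⟨huv.1, ?_⟩
      have hadj' : G.Adj u v := by rcases huv.2 with h' | h' <;> exact (hc.adj h').1
      obtain ⟨e, he⟩ := (hc₀.dom u v).1 ⟨hadj', hu, hv⟩
      have := huv.2
      rwa [hext _ _ _ he, ← he] at this
  have hgood : ∃ i, (i = a ∨ i = b) ∧ ∃ g < D + 1, g ≠ a ∧ g ≠ b ∧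
      ¬ (twoColorGraph c₀ i g).Reachable x y' := by
    by_contra! hcon
    refine hblock ⟨⟨fun h' => (hmiss c hc hext).1 (h'.mono hext), ?_⟩,
      ⟨fun h' => (hmiss c hc hext).2 (h'.mono hext), ?_⟩⟩
    · exact fun g hg hga hgb => hcon a (Or.inl rfl) g hg hga hgb
    · exact fun g hg hgb hga => hcon b (Or.inr rfl) g hg hga hgb
  obtain ⟨i, hi, g, hg, hga, hgb, hnr⟩ := hgood
  have hseen : ∀ c, Full c (isolate G S) (D + 1) →
      (∀ u v a, c₀ s(u, v) = some a → c s(u, v) = some a) → Seen c x g := by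
    intro c hc hext
    by_contra hgx
    exact hnr (hproj c hc hext i hi g hg hgx)
  obtain ⟨t, ht⟩ := hseen c hc hext
  have hxt : G.Adj x t := (hc.adj ht).1
  have htN : t ∈ smallNeighbors G x := by
    refine ⟨hxt, hp.deg_eq_two t hxt ?_ ?_⟩
    · rintro rfl
      rw [hext _ _ _ ha] at ht
      exact hga (Option.some.inj ht).symm
    · rintro rfl
      rw [hext _ _ _ hb] at ht
      exact hgb (Option.some.inj ht).symm
  have htS : t ∉ S := (hc.adj ht).2.2
  obtain ⟨d, hd⟩ := (hc.dom t (o t)).1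
    ⟨(hoadj t htN _).2 (Or.inr rfl), htS, fun h' => hoN t htN (hS h')⟩
  have hfree := hc.exists_ne_not_seen (isolate_le G S) (h.deg_le x) hxy (fun h => h.2.2 hyS)
  have hle : ∀ u v a, setColor c x t none s(u, v) = some a → c s(u, v) = some a :=
    fun u v a h' => (setColor_none_iff.1 h').2
  have hval : Valid (setColor c x t none) := hc.toValid.mono hle
  have hnt : ∀ e, e ≠ d → ¬ Seen (setColor c x t none) t e := by
    rintro e hed ⟨v, hv⟩
    obtain ⟨hne, hv⟩ := setColor_none_iff.1 hv
    rcases (hoadj t htN v).1 (hc.adj hv).1 with rfl | rfl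
    · exact hne Sym2.eq_swap
    · rw [hd] at hv
      exact hed (Option.some.inj hv).symm
  obtain ⟨f, hf, hfx, hfd, hfr⟩ : ∃ f < D + 1, ¬ Seen c x f ∧ f ≠ d ∧
      ¬ (twoColorGraph (setColor c x t none) d f).Reachable x t := by
    by_cases hdx : Seen c x d
    · obtain ⟨s, hs⟩ := hdx
      have hxs : G.Adj x s := (hc.adj hs).1
      have hst : t ≠ s := by
        rintro rfl
        exact hox t htN (hc.proper hd (color_swap hs))
      by_cases hs3 : 3 ≤ deg G s
      · have hdab : d = a ∨ d = b := by
          rcases hlarge s hxs hs3 with rfl | rfl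
          · rw [hext _ _ _ ha] at hs
            exact Or.inl (Option.some.inj hs).symm
          · rw [hext _ _ _ hb] at hs
            exact Or.inr (Option.some.inj hs).symm
        obtain ⟨f, hf, hfd, hfx⟩ := hfree d
        refine ⟨f, hf, hfx, hfd, fun hr => ?_⟩
        refine hc.not_reachable_three (Or.inr hfx) (v := y') (w := t) ?_ (Or.inr ?_) hy'x.symm hxt.ne
          ?_ (hreach c hc hext d hdab f hf hfx) (hr.mono (twoColorGraph_mono hle _ _))
        · left
          rcases hdab with rfl | rfl
          · exact (hmiss c hc hext).1
          · exact (hmiss c hc hext).2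
        · rintro ⟨v, hv⟩
          rcases (hoadj t htN v).1 (hc.adj hv).1 with rfl | rfl
          · exact hfx ⟨_, color_swap hv⟩
          · rw [hd] at hv
            exact hfd (Option.some.inj hv).symm
        · rintro rfl; exact hy'N htN
      · obtain ⟨e, he⟩ := hc.exists_unique_other_color (isolate_le G S) (by omega) hxs.symm
        obtain ⟨f, hf, hfe, hfx⟩ := hfree e
        have hfs : ¬ Seen c s f := by
          rintro ⟨v, hv⟩
          by_cases hvx : v = x
          · subst hvx
            exact hfx ⟨_, color_swap hv⟩
          · exact hfe (he v f hvx hv)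
        refine ⟨f, hf, hfx, ?_, fun hr => ?_⟩
        · rintro rfl; exact hfx ⟨_, hs⟩
        · exact not_reachable_of_edge hc.toValid hs hfx hfs hxt.ne' hst
            (hr.mono (twoColorGraph_mono hle _ _))
    · obtain ⟨f, hf, hfd, hfx⟩ := hfree d
      exact ⟨f, hf, hfx, hfd, not_reachable_of_not_seen (fun h' => hdx (h'.mono hle))
        (fun h' => hfx (h'.mono hle)) hxt.ne⟩
  have hval' : Valid (setColor (setColor c x t none) x t (some f)) := by
    refine hval.setColor_some hxt.ne (fun h' => hfx (h'.mono hle)) (hnt f hfd) fun e hef => ?_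
    by_cases hed : e = d
    · subst hed
      rwa [twoColorGraph_comm]
    · exact fun hr => not_reachable_of_not_seen (hnt f hfd) (hnt e hed) hxt.ne' hr.symm
  have hfull := hc.recolor (hc.adj ht) hf hval'
  obtain ⟨v, hv⟩ := hseen _ hfull (by
    intro u v e he
    have hu : u ≠ t := by rintro rfl; exact hc₀.not_seen_of_mem htN e ⟨_, he⟩
    have hv : v ≠ t := by rintro rfl; exact hc₀.not_seen_of_mem htN e ⟨_, color_swap he⟩
    have := hext _ _ _ he
    simp only [setColor_some_iff, setColor_none_iff, ne_eq, Sym2.eq_iff]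
    grind)
  rcases setColor_some_iff.1 hv with ⟨-, rfl⟩ | ⟨hne, hv⟩
  · exact hfx ⟨_, ht⟩
  · exact hne (by rw [hc.proper (hle _ _ _ hv) ht])


lemma Critical.exists_blocked (h : Critical G D) {x z₁ z₂ : V} (hp : Pivot G x z₁ z₂)
    {c₀ : Sym2 V → Option ℕ} (hc₀ : Full c₀ (isolate G (smallNeighbors G x)) (D + 1)) {a b : ℕ}
    (ha : c₀ s(x, z₁) = some a) (hb : c₀ s(x, z₂) = some b) :
    ∃ y ∈ smallNeighbors G x, ∃ y', y' ≠ x ∧ (∀ v, G.Adj y v ↔ v = x ∨ v = y') ∧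
      Blocked c₀ (D + 1) x y' a b ∧ Blocked c₀ (D + 1) x y' b a := by
  by_contra! hcon
  have key : ∀ n, ∀ S ⊆ smallNeighbors G x, S.ncard = n → ∀ c, Full c (isolate G S) (D + 1) →
      ¬ ∀ u v e, c₀ s(u, v) = some e → c s(u, v) = some e := by
    intro n
    induction n with
    | zero =>
      intro S hS hn c hc _
      rw [Set.ncard_eq_zero] at hn
      subst hn
      rw [isolate_empty] at hc
      exact h.not_colorable ⟨c, hc⟩
    | succ n ih =>
      intro S hS hn c hc hext
      obtain ⟨y, hy⟩ : S.Nonempty := by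
        rw [← Set.ncard_pos]; omega
      obtain ⟨y', hy'x, hadj⟩ := exists_adj_of_deg_eq_two (hS hy).2 (hS hy).1.symm
      obtain ⟨c', hc', hext'⟩ := h.exists_extend hp hc₀ ha hb hS hy hy'x hadj
        (fun hbl => hcon y (hS hy) y' hy'x hadj hbl.1 hbl.2) hc hext
      refine ih _ (Set.sdiff_subset.trans hS) ?_ c' hc' hext'
      have := Set.ncard_sdiff_singleton_add_one hy
      omega
  exact key _ _ subset_rfl rfl c₀ hc₀ fun _ _ _ h => h

lemma Critical.exists_linked_of_extends (h : Critical G D) {x z₁ z₂ : V} (hp : Pivot G x z₁ z₂)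
    {c₀ : Sym2 V → Option ℕ} (hc₀ : Full c₀ (isolate G (smallNeighbors G x)) (D + 1)) {a a' : ℕ}
    (ha : c₀ s(x, z₁) = some a) (ha' : c₀ s(x, z₂) = some a') {b : Sym2 V → Option ℕ}
    (hcb : ∀ u v e, u ≠ x → v ≠ x → c₀ s(u, v) = some e → b s(u, v) = some e)
    (hbc : ∀ u v e, b s(u, v) = some e → c₀ s(u, v) = some e) :
    ∃ y ∈ smallNeighbors G x, ∃ v, (∀ w, G.Adj y w ↔ w = x ∨ w = v) ∧
      Linked b (D + 1) z₁ z₂ v a a' := by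
  obtain ⟨y, hy, v, hvx, hadj, h1, h2⟩ := h.exists_blocked hp hc₀ ha ha'
  have hx : ∀ w e, c₀ s(x, w) = some e → w = z₁ ∧ e = a ∨ w = z₂ ∧ e = a' := by
    intro w e hw
    obtain ⟨hxw, -, hwN⟩ := hc₀.adj hw
    by_cases hw1 : w = z₁
    · subst hw1
      rw [hw] at ha
      exact Or.inl ⟨rfl, Option.some.inj ha⟩
    by_cases hw2 : w = z₂
    · subst hw2
      rw [hw] at ha'
      exact Or.inr ⟨rfl, Option.some.inj ha'⟩
    · exact absurd ⟨hxw, hp.deg_eq_two w hxw hw1 hw2⟩ hwN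
  have haa : a ≠ a' := by
    rintro rfl
    exact hp.ne (hc₀.proper ha ha')
  refine ⟨y, hy, v, hadj, ?_, ?_, fun hs => h1.not_seen (hs.mono hbc),
    fun hs => h2.not_seen (hs.mono hbc), fun g hg hga hga' => ?_, fun g hg hga hga' => ?_⟩
  · rintro rfl
    exact h1.not_seen ⟨_, color_swap ha⟩
  · rintro rfl
    exact h2.not_seen ⟨_, color_swap ha'⟩
  · refine reachable_of_pendant hcb ?_ hp.adj₁.ne' hvx (h1.reachable g hg hga hga')
    rintro w ⟨-, hw | hw⟩ <;> have := hx _ _ hw <;> grind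
  · refine reachable_of_pendant hcb ?_ hp.adj₂.ne' hvx (h2.reachable g hg hga' hga)
    rintro w ⟨-, hw | hw⟩ <;> have := hx _ _ hw <;> grind

lemma Critical.exists_linked (h : Critical G D) {x z₁ z₂ : V} (hp : Pivot G x z₁ z₂)
    {b : Sym2 V → Option ℕ} (hb : Full b (isolate G (insert x (smallNeighbors G x))) (D + 1))
    {a a' : ℕ} (ha : a < D + 1) (ha' : a' < D + 1) (haa : a ≠ a') (h1 : ¬ Seen b z₁ a)
    (h2 : ¬ Seen b z₂ a) (h2' : ¬ Seen b z₂ a') :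
    ∃ y ∈ smallNeighbors G x, ∃ v, (∀ w, G.Adj y w ↔ w = x ∨ w = v) ∧
      Linked b (D + 1) z₁ z₂ v a a' := by
  have hxb := hb.not_seen_of_mem (Set.mem_insert x _)
  have hzN₁ : z₁ ∉ smallNeighbors G x := fun h' => by have := h'.2; have := hp.three_le₁; omega
  have hzN₂ : z₂ ∉ smallNeighbors G x := fun h' => by have := h'.2; have := hp.three_le₂; omega
  have hxN : x ∉ smallNeighbors G x := fun hx => hx.1.ne rfl
  have hv1 : Valid (setColor b x z₁ (some a)) :=
    hb.setColor_some hp.adj₁.ne (hxb a) h1 fun g _ =>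
      not_reachable_of_not_seen (hxb a) (hxb g) hp.adj₁.ne
  have hz2 : ∀ e, ¬ Seen b z₂ e → ¬ Seen (setColor b x z₁ (some a)) z₂ e := by
    rintro e he ⟨w, hw⟩
    rcases setColor_some_iff.1 hw with ⟨h', -⟩ | ⟨-, hw⟩
    · rw [Sym2.eq_iff] at h'
      have := hp.ne
      have := hp.adj₂.ne
      grind
    · exact he ⟨_, hw⟩
  have hxs : ∀ e, e ≠ a → ¬ Seen (setColor b x z₁ (some a)) x e := by
    rintro e he ⟨w, hw⟩
    rcases setColor_some_iff.1 hw with ⟨-, h'⟩ | ⟨-, hw⟩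
    · exact he h'.symm
    · exact hxb e ⟨_, hw⟩
  have hv2 : Valid (setColor (setColor b x z₁ (some a)) x z₂ (some a')) := by
    refine hv1.setColor_some hp.adj₂.ne (hxs a' haa.symm) (hz2 a' h2') fun g hg => ?_
    by_cases hga : g = a
    · subst hga
      exact fun hr => not_reachable_of_not_seen (hz2 _ h2') (hz2 _ h2) hp.adj₂.ne' hr.symm
    · exact not_reachable_of_not_seen (hxs _ haa.symm) (hxs _ hga) hp.adj₂.ne
  have hf1 : Full (setColor b x z₁ (some a))
      (isolate G (insert x (smallNeighbors G x)) ⊔ edge x z₁) (D + 1) := by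
    refine hb.mk_setColor ha hv1 fun p q => ?_
    rw [sup_adj, edge_adj, Sym2.eq_iff]
    have := hp.adj₁.ne
    grind
  have hf2 : Full (setColor (setColor b x z₁ (some a)) x z₂ (some a'))
      (isolate G (smallNeighbors G x)) (D + 1) := by
    refine hf1.mk_setColor ha' hv2 fun p q => ?_
    have hd : ∀ w, G.Adj x w → w ∉ smallNeighbors G x → w = z₁ ∨ w = z₂ := by
      intro w hw hwN
      by_contra! hcon
      exact hwN ⟨hw, hp.deg_eq_two w hw hcon.1 hcon.2⟩
    have hpq := G.adj_comm p q
    have h3 := hp.adj₁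
    have h4 := hp.adj₂
    have h5 := hd p
    have h6 := hd q
    have h7 := h3.ne
    rw [sup_adj, edge_adj, Sym2.eq_iff]
    simp only [isolate, Set.mem_insert_iff]
    grind
  refine h.exists_linked_of_extends hp hf2 ?_ ?_ ?_ ?_
  · refine setColor_some_iff.2 (Or.inr ⟨?_, setColor_some_iff.2 (Or.inl ⟨rfl, rfl⟩)⟩)
    simp [hp.ne, hp.adj₁.ne']
  · exact setColor_some_iff.2 (Or.inl ⟨rfl, rfl⟩)
  · intro u v e hu hv he
    simp only [setColor_some_iff, Sym2.eq_iff] at he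
    grind
  · intro u v e he
    have hu : u ≠ x := by rintro rfl; exact hxb e ⟨_, he⟩
    have hv : v ≠ x := by rintro rfl; exact hxb e ⟨_, color_swap he⟩
    simp only [setColor_some_iff, ne_eq, Sym2.eq_iff]
    grind

lemma Critical.not_seen_of_extends (h : Critical G D) {x z₁ z₂ : V} (hp : Pivot G x z₁ z₂)
    {c₀ : Sym2 V → Option ℕ} (hc₀ : Full c₀ (isolate G (smallNeighbors G x)) (D + 1)) {a a' : ℕ}
    (ha : c₀ s(x, z₁) = some a) (ha' : c₀ s(x, z₂) = some a') {b : Sym2 V → Option ℕ}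
    (hcb : ∀ u v e, u ≠ x → v ≠ x → c₀ s(u, v) = some e → b s(u, v) = some e)
    (hbc : ∀ u v e, b s(u, v) = some e → c₀ s(u, v) = some e) (hx : ∀ e, ¬ Seen b x e) :
    ¬ Seen b z₁ a ∧ ¬ Seen b z₁ a' := by
  obtain ⟨-, -, v, -, hl⟩ := h.exists_linked_of_extends hp hc₀ ha ha' hcb hbc
  have h1 : ¬ Seen b z₁ a := by
    rintro ⟨w, hw⟩
    have := hc₀.proper (hbc _ _ _ hw) (color_swap ha)
    subst this
    exact hx a ⟨_, color_swap hw⟩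
  refine ⟨h1, ?_⟩
  obtain ⟨e, he, hez⟩ := hc₀.exists_not_seen (isolate_le G _) (h.deg_le z₁)
  have hea : e ≠ a := by
    rintro rfl
    exact hez ⟨_, color_swap ha⟩
  by_cases hea' : e = a'
  · subst hea'
    exact fun hs => hez (hs.mono hbc)
  · exact absurd ((hl.seen h1 he hea hea').mono hbc) hez

lemma Critical.exists_coloring_missing (h : Critical G D) {x z₁ z₂ : V} (hp : Pivot G x z₁ z₂)
    (hN : (smallNeighbors G x).Nonempty) :
    ∃ b a a', Full b (isolate G (insert x (smallNeighbors G x))) (D + 1) ∧ a < D + 1 ∧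
      a' < D + 1 ∧ a ≠ a' ∧ ¬ Seen b z₁ a ∧ ¬ Seen b z₁ a' ∧ ¬ Seen b z₂ a ∧ ¬ Seen b z₂ a' := by
  obtain ⟨y, hy⟩ := hN
  obtain ⟨c₀, hc₀⟩ := h.colorable_of_lt _ (isolate_lt hy.1.symm hy)
  have hzN₁ : z₁ ∉ smallNeighbors G x := fun h' => by have := h'.2; have := hp.three_le₁; omega
  have hzN₂ : z₂ ∉ smallNeighbors G x := fun h' => by have := h'.2; have := hp.three_le₂; omega
  have hxN : x ∉ smallNeighbors G x := fun hx => hx.1.ne rfl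
  obtain ⟨a, ha⟩ := (hc₀.dom x z₁).1 ⟨hp.adj₁, hxN, hzN₁⟩
  obtain ⟨a', ha'⟩ := (hc₀.dom x z₂).1 ⟨hp.adj₂, hxN, hzN₂⟩
  have hd : ∀ w e, c₀ s(x, w) = some e → w = z₁ ∨ w = z₂ := by
    intro w e hw
    by_contra! hcon
    obtain ⟨hxw, -, hwN⟩ := hc₀.adj hw
    exact hwN ⟨hxw, hp.deg_eq_two w hxw hcon.1 hcon.2⟩
  let b := setColor (setColor c₀ x z₁ none) x z₂ none
  have hbc : ∀ u v e, b s(u, v) = some e → c₀ s(u, v) = some e := fun u v e he =>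
    (setColor_none_iff.1 (setColor_none_iff.1 he).2).2
  have hcb : ∀ u v e, u ≠ x → v ≠ x → c₀ s(u, v) = some e → b s(u, v) = some e := by
    intro u v e hu hv he
    simp only [b, setColor_none_iff, ne_eq, Sym2.eq_iff]
    grind
  have hx : ∀ e, ¬ Seen b x e := by
    rintro e ⟨w, hw⟩
    obtain ⟨h2, hw⟩ := setColor_none_iff.1 hw
    obtain ⟨h1, hw⟩ := setColor_none_iff.1 hw
    rcases hd w e hw with rfl | rfl
    · exact h1 rfl
    · exact h2 rfl
  obtain ⟨h1, h1'⟩ := h.not_seen_of_extends hp hc₀ ha ha' hcb hbc hx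
  obtain ⟨h2', h2⟩ := h.not_seen_of_extends hp.symm hc₀ ha' ha hcb hbc hx
  refine ⟨b, a, a', ⟨hc₀.mono hbc, fun u v => ?_, fun u v e he => hc₀.lt (hbc _ _ _ he)⟩,
    hc₀.lt ha, hc₀.lt ha', ?_, h1, h1', h2, h2'⟩
  · constructor
    · rintro ⟨huv, hu, hv⟩
      rw [Set.mem_insert_iff, not_or] at hu hv
      obtain ⟨e, he⟩ := (hc₀.dom u v).1 ⟨huv, hu.2, hv.2⟩
      exact ⟨e, hcb _ _ _ hu.1 hv.1 he⟩
    · rintro ⟨e, he⟩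
      obtain ⟨huv, hu, hv⟩ := hc₀.adj (hbc _ _ _ he)
      refine ⟨huv, ?_, ?_⟩
      · rintro (rfl | h')
        · exact hx e ⟨_, he⟩
        · exact hu h'
      · rintro (rfl | h')
        · exact hx e ⟨_, color_swap he⟩
        · exact hv h'
  · rintro rfl
    exact hp.ne (hc₀.proper ha ha')

lemma Critical.three_le_deg_of_linked (h : Critical G D) {x z₁ z₂ : V} (hp : Pivot G x z₁ z₂)
    {b : Sym2 V → Option ℕ} (hb : Full b (isolate G (insert x (smallNeighbors G x))) (D + 1))
    {a a' : ℕ} (ha : a < D + 1) (ha' : a' < D + 1) (haa : a ≠ a') (h1 : ¬ Seen b z₁ a)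
    (h1' : ¬ Seen b z₁ a') (h2 : ¬ Seen b z₂ a) (h2' : ¬ Seen b z₂ a')
    {t : V} (ht : Linked b (D + 1) z₁ z₂ t a' a) {w r : V} {β : ℕ} (hw : b s(z₁, w) = some β)
    (hr : b s(w, r) = some a') : 3 ≤ deg G r := by
  by_contra! hdeg
  have hβa : β ≠ a := by rintro rfl; exact h1 ⟨_, hw⟩
  have hβa' : β ≠ a' := by rintro rfl; exact h1' ⟨_, hw⟩
  have hzw : z₁ ≠ w := hb.ne hw
  have hwr : w ≠ r := hb.ne hr
  have hzr : z₁ ≠ r := by rintro rfl; exact h1' ⟨_, color_swap hr⟩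
  have htw : t ≠ w := by rintro rfl; exact ht.not_seen₁ ⟨_, hr⟩
  have htr : t ≠ r := by rintro rfl; exact ht.not_seen₁ ⟨_, color_swap hr⟩
  obtain ⟨e, he⟩ := hb.exists_unique_other_color (isolate_le G _) (Nat.le_of_lt_succ hdeg)
    (hb.adj hr).1.symm
  obtain ⟨r', hr'⟩ : Seen b r β := by
    by_contra hrβ
    refine not_reachable_of_closed {z₁, w, r} ?_ (by simp) ?_
      (ht.reachable₁ β (hb.lt hw) hβa' hβa)
    · rintro p q (rfl | rfl | rfl) ⟨-, hq | hq⟩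
      · exact absurd ⟨_, hq⟩ h1'
      · exact Or.inr (Or.inl (hb.proper hq hw))
      · exact Or.inr (Or.inr (hb.proper hq hr))
      · exact Or.inl (hb.proper hq (color_swap hw))
      · exact Or.inr (Or.inl (hb.proper hq (color_swap hr)))
      · exact absurd ⟨_, hq⟩ hrβ
    · simp [ht.ne₁, htw, htr]
  have hrw : ∀ v f, b s(r, v) = some f → v = w ∨ f = β := by
    intro v f hv
    by_cases hvw : v = w
    · exact Or.inl hvw
    · right
      rw [he v f hvw hv, ← he r' β _ hr']
      rintro rfl
      rw [color_swap hr] at hr'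
      exact hβa' (Option.some.inj hr').symm
  obtain ⟨η, hη, hηw⟩ := hb.exists_not_seen (isolate_le G _) (h.deg_le w)
  have hηβ : η ≠ β := by rintro rfl; exact hηw ⟨_, color_swap hw⟩
  have hηa' : η ≠ a' := by rintro rfl; exact hηw ⟨_, hr⟩
  let e₀ := setColor (setColor b z₁ w none) w r none
  have he₀ : ∀ u v f, e₀ s(u, v) = some f →
      b s(u, v) = some f ∧ s(u, v) ≠ s(z₁, w) ∧ s(u, v) ≠ s(w, r) := by
    intro u v f hf
    obtain ⟨hf1, hf⟩ := setColor_none_iff.1 hf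
    obtain ⟨hf2, hf⟩ := setColor_none_iff.1 hf
    exact ⟨hf, hf2, hf1⟩
  have hr₀ : ∀ f, f ≠ β → ¬ Seen e₀ r f := by
    rintro f hfβ ⟨v, hv⟩
    obtain ⟨hv, -, hne⟩ := he₀ _ _ _ hv
    rcases hrw v f hv with rfl | rfl
    · exact hne Sym2.eq_swap
    · exact hfβ rfl
  have hw₀ : ∀ f, f = β ∨ f = η ∨ f = a' → ¬ Seen e₀ w f := by
    rintro f hf ⟨v, hv⟩
    obtain ⟨hv, hne, hne'⟩ := he₀ _ _ _ hv
    rcases hf with rfl | rfl | rfl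
    · rw [hb.proper hv (color_swap hw)] at hne
      exact hne Sym2.eq_swap
    · exact hηw ⟨_, hv⟩
    · rw [hb.proper hv hr] at hne'
      exact hne' rfl
  have hv₁ : Valid (setColor e₀ w r (some η)) := by
    refine (hb.toValid.mono fun u v f hf => (he₀ u v f hf).1).setColor_some hwr
      (hw₀ η (by simp)) (hr₀ η hηβ) fun δ _ => ?_
    by_cases hδ : δ = β
    · exact not_reachable_of_not_seen (hw₀ _ (by simp)) (hw₀ _ (by simp [hδ])) hwr
    · exact fun hreach =>
        not_reachable_of_not_seen (hr₀ _ hηβ) (hr₀ _ hδ) hwr.symm hreach.symm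
  set e₁ := setColor e₀ w r (some η) with he₁
  have he₁b : ∀ u v f, f ≠ η → e₁ s(u, v) = some f → b s(u, v) = some f := by
    intro u v f hf hv
    rcases setColor_some_iff.1 hv with ⟨-, rfl⟩ | ⟨-, hv⟩
    · exact absurd rfl hf
    · exact (he₀ _ _ _ hv).1
  have hz₁ : ∀ v f, e₁ s(z₁, v) = some f → b s(z₁, v) = some f ∧ v ≠ w := by
    intro v f hv
    rcases setColor_some_iff.1 hv with ⟨h', -⟩ | ⟨-, hv⟩
    · rw [Sym2.eq_iff] at h'
      grind
    · obtain ⟨hv, hne, -⟩ := he₀ _ _ _ hv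
      exact ⟨hv, by rintro rfl; exact hne rfl⟩
  have hz₁a' : ¬ Seen e₁ z₁ a' := fun ⟨v, hv⟩ => h1' ⟨v, (hz₁ v _ hv).1⟩
  have hwa' : ¬ Seen e₁ w a' := by
    rintro ⟨v, hv⟩
    rcases setColor_some_iff.1 hv with ⟨-, h'⟩ | ⟨-, hv⟩
    · exact hηa' h'
    · exact hw₀ a' (by simp) ⟨v, hv⟩
  have hv₂ : Valid (setColor e₁ z₁ w (some a')) := by
    refine hv₁.setColor_some hzw hz₁a' hwa' fun δ hδa' hreach => ?_
    by_cases hδβ : δ = β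
    · subst hδβ
      refine not_reachable_of_not_seen hz₁a' ?_ hzw hreach
      rintro ⟨v, hv⟩
      exact (hz₁ v _ hv).2 (hb.proper (hz₁ v _ hv).1 hw)
    by_cases hδa : δ = a
    · subst hδa
      exact not_reachable_of_not_seen hz₁a' (fun ⟨v, hv⟩ => h1 ⟨v, (hz₁ v _ hv).1⟩) hzw hreach
    by_cases hδη : δ = η
    · subst hδη
      rw [twoColorGraph_comm] at hreach
      refine not_reachable_of_edge hv₁ (setColor_some_iff.2 (Or.inl ⟨rfl, rfl⟩)) hwa' ?_ hzw hzr
        hreach.symm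
      rintro ⟨v, hv⟩
      rcases setColor_some_iff.1 hv with ⟨-, h'⟩ | ⟨-, hv⟩
      · exact hηa' h'
      · exact hr₀ a' hβa'.symm ⟨v, hv⟩
    by_cases hwδ : Seen e₁ w δ
    · obtain ⟨_, hwδ⟩ := hwδ
      have hδ := hb.lt (he₁b _ _ _ hδη hwδ)
      have hle : twoColorGraph e₁ a' δ ≤ twoColorGraph b a' δ := fun p q hpq =>
        ⟨hpq.1, hpq.2.imp (he₁b _ _ _ hηa'.symm) (he₁b _ _ _ hδη)⟩
      have hadj : (twoColorGraph b a' δ).Adj w r := ⟨hwr, Or.inl hr⟩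
      refine hb.not_reachable_three (Or.inl h1') (Or.inr ?_) (Or.inl ht.not_seen₁) hzr
        ht.ne₁.symm htr.symm ((hreach.mono hle).trans hadj.reachable) (ht.reachable₁ δ hδ hδa' hδa)
      rintro ⟨v, hv⟩
      rcases hrw v _ hv with rfl | rfl
      · rw [color_swap hr] at hv
        exact hδa' (Option.some.inj hv).symm
      · exact hδβ rfl
    · exact not_reachable_of_not_seen hwa' hwδ hzw.symm hreach.symm
  have hfull : Full (setColor e₁ z₁ w (some a'))
      (isolate G (insert x (smallNeighbors G x))) (D + 1) := by
    refine ⟨hv₂, fun p q => ?_, fun p q f hf => ?_⟩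
    · rw [hb.dom]
      simp only [he₁, e₀, setColor_some_iff, setColor_none_iff]
      by_cases hp1 : s(p, q) = s(z₁, w)
      · simp [hp1, hw]
      by_cases hp2 : s(p, q) = s(w, r)
      · simp only [hp2, hr]
        grind
      · simp [hp1, hp2]
    · rcases setColor_some_iff.1 hf with ⟨-, rfl⟩ | ⟨-, hf⟩
      · exact ha'
      by_cases hfη : f = η
      · rwa [hfη]
      · exact hb.lt (he₁b _ _ _ hfη hf)
  have hz₂w : z₂ ≠ w := by rintro rfl; exact h2' ⟨_, hr⟩
  have hz₂r : z₂ ≠ r := by rintro rfl; exact h2' ⟨_, color_swap hr⟩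
  have hz₂ : ∀ f, ¬ Seen b z₂ f → ¬ Seen (setColor e₁ z₁ w (some a')) z₂ f := by
    rintro f hf ⟨v, hv⟩
    rcases setColor_some_iff.1 hv with ⟨h', -⟩ | ⟨-, hv⟩
    · rw [Sym2.eq_iff] at h'
      have := hp.ne
      grind
    rcases setColor_some_iff.1 hv with ⟨h', -⟩ | ⟨-, hv⟩
    · rw [Sym2.eq_iff] at h'
      grind
    · exact hf ⟨v, (he₀ _ _ _ hv).1⟩
  have hz₁f : ∀ f, f ≠ a' → Seen (setColor e₁ z₁ w (some a')) z₁ f →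
      ∃ v, b s(z₁, v) = some f ∧ v ≠ w := by
    rintro f hf ⟨v, hv⟩
    rcases setColor_some_iff.1 hv with ⟨-, h'⟩ | ⟨-, hv⟩
    · exact absurd h'.symm hf
    · exact ⟨v, hz₁ v f hv⟩
  have hz₁a : ¬ Seen (setColor e₁ z₁ w (some a')) z₁ a := fun hs =>
    have ⟨v, hv, _⟩ := hz₁f a haa hs
    h1 ⟨v, hv⟩
  obtain ⟨-, -, v, -, hl⟩ := h.exists_linked hp hfull ha ha' haa hz₁a (hz₂ a h2) (hz₂ a' h2')
  obtain ⟨u, hu, huw⟩ := hz₁f β hβa' (hl.seen hz₁a (hb.lt hw) hβa hβa')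
  exact huw (hb.proper hu hw)

lemma Critical.three_le_ncard_of_pivot (h : Critical G D) {x z₁ z₂ : V} (hp : Pivot G x z₁ z₂)
    (hN : (smallNeighbors G x).Nonempty) :
    3 ≤ ({w | 3 ≤ deg G w ∧ 3 ≤ ({u | 3 ≤ deg G u} ∩ G.neighborSet w).ncard} ∩
      G.neighborSet z₁).ncard := by
  obtain ⟨b, a, a', hb, ha, ha', haa, h1, h1', h2, h2'⟩ := h.exists_coloring_missing hp hN
  obtain ⟨y, hy, v, hyadj, hv⟩ := h.exists_linked hp hb ha ha' haa h1 h2 h2'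
  obtain ⟨s, hs, t, hsadj, ht⟩ := h.exists_linked hp hb ha' ha haa.symm h1' h2' h2
  have hD : 3 ≤ D := hp.three_le₁.trans (h.deg_le z₁)
  have hcard : D - 1 ≤ (((Finset.range (D + 1)).erase a).erase a').card := by
    have := Finset.pred_card_le_card_erase (s := (Finset.range (D + 1)).erase a) (a := a')
    have := Finset.pred_card_le_card_erase (s := Finset.range (D + 1)) (a := a)
    rw [Finset.card_range] at this
    omega
  have hvt : v ≠ t := by
    rintro rfl
    obtain ⟨g, hg⟩ : (((Finset.range (D + 1)).erase a).erase a').Nonempty := by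
      rw [← Finset.card_pos]; omega
    simp only [Finset.mem_erase, Finset.mem_range] at hg
    exact hb.not_reachable_three (Or.inl hv.not_seen₁) (Or.inl h1) (Or.inl h2) hv.ne₁ hv.ne₂ hp.ne
      (hv.reachable₁ g hg.2.2 hg.2.1 hg.1).symm (ht.reachable₂ g hg.2.2 hg.1 hg.2.1).symm
  have hys : y ≠ s := by
    rintro rfl
    have h3 := (hsadj v).1 ((hyadj v).2 (Or.inr rfl))
    have h4 := (hyadj t).1 ((hsadj t).2 (Or.inr rfl))
    grind
  have hD4 : 4 ≤ D := by
    have h3 : ({z₁, z₂, y, s} : Set V).ncard = 4 := by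
      have := hy.2
      have := hs.2
      have := hp.three_le₁
      have := hp.three_le₂
      have := hp.ne
      rw [Set.ncard_insert_of_notMem, Set.ncard_insert_of_notMem, Set.ncard_pair hys]
      · simp only [Set.mem_insert_iff, Set.mem_singleton_iff]
        rintro (rfl | rfl) <;> omega
      · simp only [Set.mem_insert_iff, Set.mem_singleton_iff]
        rintro (rfl | rfl | rfl) <;> first | omega | contradiction
    rw [← h3]
    refine le_trans (Set.ncard_le_ncard ?_ (Set.toFinite _)) (h.deg_le x)
    rintro w (rfl | rfl | rfl | rfl)
    · exact hp.adj₁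
    · exact hp.adj₂
    · exact hy.1
    · exact hs.1
  have hmain := card_le_of_seen (c := b) (x := z₁) (((Finset.range (D + 1)).erase a).erase a')
    ({w | 3 ≤ deg G w ∧ 3 ≤ ({u | 3 ≤ deg G u} ∩ G.neighborSet w).ncard} ∩ G.neighborSet z₁) ?_
  · omega
  intro g hg
  simp only [Finset.mem_erase, Finset.mem_range] at hg
  obtain ⟨hga', hga, hg⟩ := hg
  obtain ⟨w, hw⟩ := hv.seen h1 hg hga hga'
  have hwv : ¬ Seen b w a → w = v := by
    intro hwa
    by_contra hne
    refine not_reachable_of_edge hb.toValid hw h1 hwa hv.ne₁ (Ne.symm hne) ?_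
    rw [twoColorGraph_comm]
    exact hv.reachable₁ g hg hga hga'
  have hwt : ¬ Seen b w a' → w = t := by
    intro hwa
    by_contra hne
    refine not_reachable_of_edge hb.toValid hw h1' hwa ht.ne₁ (Ne.symm hne) ?_
    rw [twoColorGraph_comm]
    exact ht.reachable₁ g hg hga' hga
  obtain ⟨p, hwp⟩ : Seen b w a := by
    by_contra hwa
    have h3 := hwv hwa
    have h4 := hwt (by rw [h3]; exact hv.not_seen₂)
    exact hvt (h3.symm.trans h4)
  obtain ⟨q, hwq⟩ : Seen b w a' := by
    by_contra hwa
    have h4 := hwt hwa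
    have h3 := hwv (by rw [h4]; exact ht.not_seen₂)
    exact hvt (h3.symm.trans h4)
  have hp3 := h.three_le_deg_of_linked hp hb ha' ha haa.symm h1' h1 h2' h2 hv hw hwp
  have hq3 := h.three_le_deg_of_linked hp hb ha ha' haa h1 h1' h2 h2' ht hw hwq
  have hlarge : 3 ≤ ({u | 3 ≤ deg G u} ∩ G.neighborSet w).ncard := by
    have h3 : ({z₁, p, q} : Set V).ncard = 3 := by
      rw [Set.ncard_eq_three]
      refine ⟨z₁, p, q, ?_, ?_, ?_, rfl⟩
      · rintro rfl; exact h1 ⟨_, color_swap hwp⟩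
      · rintro rfl; exact h1' ⟨_, color_swap hwq⟩
      · rintro rfl
        rw [hwp] at hwq
        exact haa (Option.some.inj hwq)
    refine h3.ge.trans (Set.ncard_le_ncard ?_ (Set.toFinite _))
    rintro u (rfl | rfl | rfl)
    · exact ⟨hp.three_le₁, (hb.adj hw).1.symm⟩
    · exact ⟨hp3, (hb.adj hwp).1⟩
    · exact ⟨hq3, (hb.adj hwq).1⟩
  exact ⟨w, ⟨⟨hlarge.trans (Set.ncard_le_ncard Set.inter_subset_right (Set.toFinite _)), hlarge⟩,
    (hb.adj hw).1⟩, hw⟩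

lemma Critical.exists_pivot (h : Critical G D) {x : V} (hx : 3 ≤ deg G x)
    (hx2 : ({u | 3 ≤ deg G u} ∩ G.neighborSet x).ncard ≤ 2) :
    ∃ z₁ z₂, Pivot G x z₁ z₂ ∧ (smallNeighbors G x).Nonempty := by
  have hsmall : ∀ v, G.Adj x v → deg G v < 3 → deg G v = 2 := by
    intro v hv hlt
    have h1 := h.deg_ne_one v
    have h0 : 0 < deg G v := (Set.ncard_pos (Set.toFinite _)).2 ⟨x, hv.symm⟩
    omega
  obtain ⟨y, hxy, hy⟩ : ∃ y, G.Adj x y ∧ deg G y < 3 := by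
    by_contra! hcon
    have : {u | 3 ≤ deg G u} ∩ G.neighborSet x = G.neighborSet x :=
      Set.inter_eq_right.2 fun v hv => hcon v hv
    rw [this] at hx2
    unfold deg at hx
    omega
  obtain ⟨s₁, s₂, hs, hs1, hs2, h31, h32⟩ := h.exists_two_large (hsmall y hxy hy) hxy.symm
  refine ⟨s₁, s₂, ⟨hs, hs1, hs2, h31, h32, fun v hv hv1 hv2 => hsmall v hv ?_⟩,
    y, hxy, hsmall y hxy hy⟩
  by_contra! hv3
  have h3 : ({s₁, s₂, v} : Set V).ncard = 3 :=
    Set.ncard_eq_three.2 ⟨s₁, s₂, v, hs, hv1.symm, hv2.symm, rfl⟩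
  have h4 : ({s₁, s₂, v} : Set V).ncard ≤ ({u | 3 ≤ deg G u} ∩ G.neighborSet x).ncard := by
    refine Set.ncard_le_ncard ?_ (Set.toFinite _)
    rintro u (rfl | rfl | rfl)
    · exact ⟨h31, hs1⟩
    · exact ⟨h32, hs2⟩
    · exact ⟨hv3, hv⟩
  omega

lemma Critical.exists_three_le_deg (h : Critical G D) : ∃ v, 3 ≤ deg G v := by
  by_contra! hcon
  refine h.not_colorable ⟨fun _ => none, ⟨by simp, by simp, fun a b => ?_⟩, fun u v => ?_, by simp⟩
  · convert isAcyclic_bot (V := V)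
    ext u v
    simp [twoColorGraph]
  · simp only [reduceCtorEq, exists_false, iff_false]
    intro huv
    have h0 : 0 < deg G u := (Set.ncard_pos (Set.toFinite _)).2 ⟨v, huv⟩
    have h1 := h.deg_ne_one u
    have h2 := hcon u
    obtain ⟨s, -, -, -, -, hs, -⟩ := h.exists_two_large (by omega) huv
    exact absurd hs (hcon s).not_ge

lemma not_critical (hG : ∀ S : Set V, S.Nonempty → ∃ v ∈ S, (S ∩ G.neighborSet v).ncard ≤ 2) :
    ¬ Critical G D := by
  intro h
  set B : Set V := {u | 3 ≤ deg G u} with hB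
  set C : Set V := {w | 3 ≤ deg G w ∧ 3 ≤ (B ∩ G.neighborSet w).ncard} with hC
  obtain ⟨z, x, hx, hx2, hzx, hz⟩ : ∃ z x, 3 ≤ deg G x ∧ (B ∩ G.neighborSet x).ncard ≤ 2 ∧
      (C.Nonempty → G.Adj x z ∧ 3 ≤ deg G z) ∧ (C ∩ G.neighborSet z).ncard ≤ 2 := by
    by_cases hne : C.Nonempty
    · obtain ⟨z, hz, hz2⟩ := hG C hne
      obtain ⟨x, hx, hxC⟩ : ∃ x ∈ B ∩ G.neighborSet z, x ∉ C ∩ G.neighborSet z := by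
        refine Set.exists_mem_notMem_of_ncard_lt_ncard ?_ (Set.toFinite _)
        have := hz.2
        omega
      refine ⟨z, x, hx.1, ?_, fun _ => ⟨hx.2.symm, hz.1⟩, hz2⟩
      by_contra! hx3
      exact hxC ⟨⟨hx.1, hx3⟩, hx.2⟩
    · obtain ⟨x, hx⟩ := h.exists_three_le_deg
      rw [Set.not_nonempty_iff_eq_empty] at hne
      refine ⟨x, x, hx, ?_, by simp [hne], by simp [hne]⟩
      by_contra! hx3
      have : x ∈ C := ⟨hx, hx3⟩
      simp [hne] at this
  obtain ⟨z₁, z₂, hp, hN⟩ := h.exists_pivot hx hx2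
  have h1 := h.three_le_ncard_of_pivot hp hN
  have h2 := h.three_le_ncard_of_pivot hp.symm hN
  have hCne : C.Nonempty := by
    refine Set.Nonempty.mono Set.inter_subset_left ((Set.ncard_pos (Set.toFinite _)).1
      (lt_of_lt_of_le (by norm_num) h1))
  obtain ⟨hxz, hz3⟩ := hzx hCne
  by_cases hz1 : z = z₁
  · subst hz1
    exact absurd hz (not_le.2 h1)
  by_cases hz2 : z = z₂
  · subst hz2
    exact absurd hz (not_le.2 h2)
  have := hp.deg_eq_two z hxz hz1 hz2
  omega

/-- A graph of maximum degree at most `D` in which every nonempty set of vertices induces a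
subgraph with a vertex of degree at most two has an acyclic edge coloring with `D + 1` colors. -/
theorem exists_full_of_degenerate (D : ℕ) (G : SimpleGraph V)
    (hG : ∀ S : Set V, S.Nonempty → ∃ v ∈ S, (S ∩ G.neighborSet v).ncard ≤ 2)
    (hdeg : ∀ v, deg G v ≤ D) : ∃ c, Full c G (D + 1) := by
  induction G using WellFoundedLT.induction with
  | ind G ih =>
    by_contra hno
    refine not_critical hG ⟨hdeg, hno, fun G' hlt => ih G' hlt (fun S hS => ?_) fun v => ?_⟩
    · obtain ⟨v, hv, h2⟩ := hG S hS
      exact ⟨v, hv, (Set.ncard_le_ncard (Set.inter_subset_inter_right _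
        (neighborSet_mono hlt.le v)) (Set.toFinite _)).trans h2⟩
    · exact (Set.ncard_le_ncard (neighborSet_mono hlt.le v) (Set.toFinite _)).trans
        (hdeg v)

end Critical

lemma Full.isAcyclicEdgeColoring {c : Sym2 V → Option ℕ} {G : SimpleGraph V} {k : ℕ}
    (hc : Full c G k) : IsAcyclicEdgeColoring G k c := by
  refine ⟨⟨⟨fun e he => ?_, fun u v w huv _ hvw _ he => ?_⟩, fun α β v W hW h => ?_⟩,
    fun e he => ?_⟩
  · induction e using Sym2.ind with
    | h u v => exact (hc.dom u v).2 (Option.isSome_iff_exists.1 he)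
  · obtain ⟨a, ha⟩ := (hc.dom u v).1 huv
    exact hvw (hc.proper ha (he ▸ ha))
  · have hmem : ∀ e ∈ W.edges, e ∈ (twoColorGraph c α β).edgeSet := by
      intro e he
      have h1 := W.edges_subset_edgeSet he
      have h2 := h e he
      induction e using Sym2.ind with
      | h u v => exact ⟨G.ne_of_adj h1, h2⟩
    exact hc.acyclic α β (W.transfer _ hmem) (hW.transfer hmem)
  · induction e using Sym2.ind with
    | h u v =>
      obtain ⟨a, ha⟩ := (hc.dom u v).1 he
      exact ⟨a, hc.lt ha, ha⟩

/-- If `G` is a 2-degenerate simple graph with maximum degree `Δ`, then `G`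
admits an acyclic edge coloring using at most `Δ+1` colors, i.e. `a'(G) ≤ Δ+1`. -/
theorem acyclicEdgeColoring_of_twoDegenerate {V : Type*} [Fintype V] [DecidableEq V]
    (G : SimpleGraph V) [DecidableRel G.Adj] (hG : TwoDegenerate G) :
    ∃ c : Sym2 V → Option ℕ, IsAcyclicEdgeColoring G (G.maxDegree + 1) c := by
  classical
  have hdegen : ∀ S : Set V, S.Nonempty → ∃ v ∈ S, (S ∩ G.neighborSet v).ncard ≤ 2 := by
    intro S hS
    obtain ⟨v, hv, h2⟩ := hG S.toFinset (by simpa using hS)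
    refine ⟨v, by simpa using hv, ?_⟩
    rw [← Set.ncard_coe_finset] at h2
    convert h2 using 2
    ext u
    simp
  have hdeg : ∀ v, deg G v ≤ G.maxDegree := by
    intro v
    rw [deg, ← coe_neighborFinset, Set.ncard_coe_finset, card_neighborFinset_eq_degree]
    exact G.degree_le_maxDegree v
  obtain ⟨c, hc⟩ := exists_full_of_degenerate G.maxDegree G hdegen hdeg
  exact ⟨c, hc.isAcyclicEdgeColoring⟩

end AEC
end

section
/- Let c be a valid (acyclic) partial edge coloring of a simple graph G in which the edge e = ab is uncolored, and let β be a candidate color for e. Then β is not valid for e if and only if there exists a color α ∈ S_ab ∩ S_ba such that there is an (α,β,ab)-critical path in G with respect to c. -/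
open SimpleGraph

namespace AEC

variable {V : Type*}

/-- The first edge of a nontrivial `(α,β)`-bichromatic walk is colored `α` if `β` does not
appear at its starting vertex. -/
theorem exists_head?_edges_eq {G : SimpleGraph V} {c : Sym2 V → Option ℕ} {α β : ℕ} {a b : V}
    (hab : a ≠ b) (hβ : β ∉ colorsAt G c a) (W : G.Walk a b)
    (hW : ∀ e ∈ W.edges, c e = some α ∨ c e = some β) :
    ∃ z, W.edges.head? = some s(a, z) ∧ G.Adj a z ∧ c s(a, z) = some α ∧ z ∈ W.support := by
  cases W with
  | nil => exact absurd rfl hab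
  | @cons _ z _ h q =>
    refine ⟨z, by simp, h, ?_, by simp⟩
    exact (hW s(a, z) (by simp)).resolve_right fun hz => hβ ⟨z, h, hz⟩

/-- If `z` is the neighbor of `a` along color `α` and `β` does not appear at `a`, every neighbor
of `a` along an `α`- or `β`-colored edge is `z`. -/
theorem ProperPartialColoring.eq_of_color {G : SimpleGraph V} {c : Sym2 V → Option ℕ}
    (hc : ProperPartialColoring G c) {α β : ℕ} {a z w : V} (hβ : β ∉ colorsAt G c a)
    (hz : G.Adj a z) (hcz : c s(a, z) = some α) (hw : G.Adj a w)
    (hcw : c s(a, w) = some α ∨ c s(a, w) = some β) : w = z := by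
  have hcw : c s(a, w) = some α := hcw.resolve_right fun h => hβ ⟨w, hw, h⟩
  by_contra hne
  exact hc.2 hw hz hne (by simp [hcw]) (hcw.trans hcz.symm)

/-- A bichromatic path between two distinct vertices neither of which sees `β` is critical. -/
theorem ProperPartialColoring.isCriticalPath {G : SimpleGraph V} {c : Sym2 V → Option ℕ}
    (hc : ProperPartialColoring G c) {α β : ℕ} {a b : V} (hab : a ≠ b)
    (hβa : β ∉ colorsAt G c a) (hβb : β ∉ colorsAt G c b) {W : G.Walk a b} (hp : W.IsPath)
    (hW : ∀ e ∈ W.edges, c e = some α ∨ c e = some β) : IsCriticalPath G c α β W := by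
  obtain ⟨x, hx, hax, hcx, hxW⟩ := exists_head?_edges_eq hab hβa W hW
  obtain ⟨y, hy, hby, hcy, hyW⟩ :=
    exists_head?_edges_eq hab.symm hβb W.reverse (by simpa using hW)
  rw [Walk.edges_reverse, List.head?_reverse] at hy
  rw [Walk.support_reverse, List.mem_reverse] at hyW
  refine ⟨⟨⟨hp, hW, fun w hw hcw => ?_, fun w hw hcw => ?_⟩, _, hx, hcx⟩, _, hy, hcy⟩
  · rwa [hc.eq_of_color hβa hax hcx hw hcw]
  · rwa [hc.eq_of_color hβb hby hcy hw hcw]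

/-- Coloring an uncolored edge with a candidate color keeps the coloring proper. -/
theorem ProperPartialColoring.update [DecidableEq V] {G : SimpleGraph V}
    {c : Sym2 V → Option ℕ} (hc : ProperPartialColoring G c) {a b : V} (hab : G.Adj a b) {β : ℕ}
    (hβa : β ∉ colorsAt G c a) (hβb : β ∉ colorsAt G c b) :
    ProperPartialColoring G (fun e => if e = s(a, b) then some β else c e) := by
  have key : ∀ ⦃u v w : V⦄, G.Adj u w → s(u, v) = s(a, b) → c s(u, w) ≠ some β := by
    intro u v w hw huv hcw
    rcases Sym2.eq_iff.mp huv with ⟨rfl, -⟩ | ⟨rfl, -⟩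
    · exact hβa ⟨w, hw, hcw⟩
    · exact hβb ⟨w, hw, hcw⟩
  refine ⟨fun e he => ?_, fun u v w hv hw hvw hs => ?_⟩
  · by_cases h : e = s(a, b)
    · rw [h]
      exact hab
    · exact hc.1 e (by simpa [h] using he)
  · dsimp only at hs ⊢
    by_cases hv' : s(u, v) = s(a, b) <;> by_cases hw' : s(u, w) = s(a, b)
    · exact absurd (Sym2.congr_right.mp (hv'.trans hw'.symm)) hvw
    · rw [if_pos hv', if_neg hw']
      exact (key hw hv').symm
    · rw [if_neg hv', if_pos hw']
      exact key hv hw'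
    · rw [if_neg hv'] at hs ⊢
      rw [if_neg hw']
      exact hc.2 hv hw hvw hs

/-- A cycle through the edge `ab` yields a path from `a` to `b` using only other edges of it. -/
theorem exists_isPath_of_isCycle {G : SimpleGraph V} {a b v : V} {W : G.Walk v v}
    (hW : W.IsCycle) (h : s(a, b) ∈ W.edges) :
    ∃ P : G.Walk a b, P.IsPath ∧ ∀ e ∈ P.edges, e ∈ W.edges ∧ e ≠ s(a, b) := by
  let H : SimpleGraph V := fromEdgeSet {e | e ∈ W.edges}
  have hWH : ∀ e ∈ W.edges, e ∈ H.edgeSet := fun e he => by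
    rw [edgeSet_fromEdgeSet]
    exact ⟨he, G.not_isDiag_of_mem_edgeSet (W.edges_subset_edgeSet he)⟩
  obtain ⟨-, hr⟩ := adj_and_reachable_delete_edges_iff_exists_cycle.mpr
    ⟨v, W.transfer H hWH, hW.transfer hWH, by rwa [Walk.edges_transfer]⟩
  obtain ⟨P, hP⟩ := hr.exists_isPath
  have hPW : ∀ e ∈ P.edges, e ∈ W.edges ∧ e ≠ s(a, b) := fun e he => by
    have h' := P.edges_subset_edgeSet he
    rw [edgeSet_deleteEdges, edgeSet_fromEdgeSet] at h'
    exact ⟨h'.1.1, h'.2⟩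
  have hPG : ∀ e ∈ P.edges, e ∈ G.edgeSet := fun e he =>
    W.edges_subset_edgeSet (hPW e he).1
  exact ⟨P.transfer G hPG, hP.transfer hPG, by rwa [Walk.edges_transfer]⟩

/-- Fact 2: let `c` be a valid partial coloring with the edge `ab` uncolored
and let `β` be a candidate color for `ab`. Then `β` is not valid for `ab` iff there is a
color `α ∈ S_ab ∩ S_ba` such that an `(α,β,ab)`-critical path exists with respect to `c`. -/
theorem candidate_not_valid_iff_criticalPath {V : Type*} [DecidableEq V]
    (G : SimpleGraph V) (c : Sym2 V → Option ℕ) (hc : AcyclicPartialColoring G c)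
    (a b : V) (hab : G.Adj a b) (huncolored : c s(a, b) = none)
    (β : ℕ) (hcanda : β ∉ colorsAt G c a) (hcandb : β ∉ colorsAt G c b) :
    ¬ AcyclicPartialColoring G (fun e => if e = s(a, b) then some β else c e) ↔
      ∃ α, α ∈ Sset G c a b ∧ α ∈ Sset G c b a ∧
        ∃ W : G.Walk a b, IsCriticalPath G c α β W := by
  constructor
  · intro hnot
    obtain ⟨α, v, W, hW, hcol⟩ : ∃ (α : ℕ) (v : V) (W : G.Walk v v), W.IsCycle ∧
        ∀ e ∈ W.edges, e = s(a, b) ∨ c e = some α ∨ c e = some β := by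
      have hex : ∃ (α γ : ℕ) (v : V) (W : G.Walk v v), W.IsCycle ∧ ∀ e ∈ W.edges,
          (if e = s(a, b) then some β else c e) = some α ∨
          (if e = s(a, b) then some β else c e) = some γ := by
        by_contra hno
        exact hnot ⟨hc.1.update hab hcanda hcandb, fun α γ v W hW hcol =>
          hno ⟨α, γ, v, W, hW, hcol⟩⟩
      obtain ⟨α, γ, v, W, hW, hcol⟩ := hex
      have hmem : s(a, b) ∈ W.edges := by
        by_contra hmem
        refine hc.2 α γ v W hW fun e he => ?_
        have hne : e ≠ s(a, b) := fun h => hmem (h ▸ he)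
        simpa [hne] using hcol e he
      have hβ : β = α ∨ β = γ := by simpa using hcol _ hmem
      rcases hβ with rfl | rfl
      · refine ⟨γ, v, W, hW, fun e he => ?_⟩
        have := hcol e he
        grind
      · refine ⟨α, v, W, hW, fun e he => ?_⟩
        have := hcol e he
        grind
    have hmem : s(a, b) ∈ W.edges := by
      by_contra hmem
      exact hc.2 α β v W hW fun e he => (hcol e he).resolve_left fun h => hmem (h ▸ he)
    obtain ⟨P, hP, hPW⟩ := exists_isPath_of_isCycle hW hmem
    have hPcol : ∀ e ∈ P.edges, c e = some α ∨ c e = some β := fun e he =>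
      (hcol e (hPW e he).1).resolve_left (hPW e he).2
    obtain ⟨x, -, hax, hcx, -⟩ := exists_head?_edges_eq hab.ne hcanda P hPcol
    obtain ⟨y, -, hby, hcy, -⟩ :=
      exists_head?_edges_eq hab.ne.symm hcandb P.reverse (by simpa using hPcol)
    refine ⟨α, ⟨y, hby, ?_, hcy⟩, ⟨x, hax, ?_, hcx⟩, P,
      hc.1.isCriticalPath hab.ne hcanda hcandb hP hPcol⟩
    · rintro rfl
      simp [Sym2.eq_swap (a := b), huncolored] at hcy
    · rintro rfl
      simp [huncolored] at hcx
  · rintro ⟨α, -, -, W, ⟨⟨hp, hcol, -, -⟩, -⟩, -⟩ hacyc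
    have hnot : s(a, b) ∉ W.edges := fun h => by simpa [huncolored] using hcol _ h
    refine hacyc.2 α β b (Walk.cons hab.symm W)
      ((Walk.cons_isCycle_iff W hab.symm).mpr ⟨hp, by rwa [Sym2.eq_swap]⟩) fun e he => ?_
    rcases List.mem_cons.mp (Walk.edges_cons hab.symm W ▸ he) with rfl | he
    · exact Or.inr (if_pos Sym2.eq_swap)
    · have hne : e ≠ s(a, b) := fun h => hnot (h ▸ he)
      simpa [hne] using hcol e he

end AEC
end

section
/- Let c be a valid (acyclic) partial edge coloring of a simple graph G, let u,i,j,a,b be vertices with ui, uj, ab edges of G, let λ, ξ be colors with {λ,ξ} ∩ {c(u,i), c(u,j)} ≠ ∅ and {i,j} ∩ {a,b} = ∅. Suppose there exists a (λ,ξ,ab)-critical path containing the vertex u with respect to c, and let c' be obtained from c by the color exchange with respect to the edges ui and uj. If c' is proper, then there is no (λ,ξ,ab)-critical path in G with respect to c'. -/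
open SimpleGraph

namespace AEC

variable {V : Type*}

section BichromaticPath

variable {G : SimpleGraph V} {c c' : Sym2 V → Option ℕ} {α β : ℕ} {a b u i j w : V}

theorem color_getVert_succ {W : G.Walk a b}
    (hW : ∀ e ∈ W.edges, c e = some α ∨ c e = some β) {k : ℕ} (hk : k < W.length) :
    c s(W.getVert k, W.getVert (k + 1)) = some α ∨
      c s(W.getVert k, W.getVert (k + 1)) = some β :=
  hW _ ((W.mk_mem_edges_iff_exists).2 ⟨k, hk, rfl⟩)

theorem mem_of_closed {S : Set V} (W : G.Walk a b)
    (hS : ∀ v w, G.Adj v w →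
      (c s(v, w) = some α ∨ c s(v, w) = some β) → v ∈ S → w ∈ S)
    (hW : ∀ e ∈ W.edges, c e = some α ∨ c e = some β) (ha : a ∈ S) : b ∈ S := by
  induction W with
  | nil => exact ha
  | cons h p ih =>
    rw [Walk.edges_cons, List.forall_mem_cons] at hW
    exact ih hW.2 (hS _ _ h hW.1 ha)

/-- At an interior vertex of a bichromatic path, both colors are used by the path. -/
theorem ProperPartialColoring.eq_of_color_getVert (hc : ProperPartialColoring G c)
    {W : G.Walk a b} (hp : W.IsPath) (hW : ∀ e ∈ W.edges, c e = some α ∨ c e = some β)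
    {k : ℕ} (hk : k + 1 < W.length) (hadj : G.Adj (W.getVert (k + 1)) w)
    (hw : c s(W.getVert (k + 1), w) = some α ∨ c s(W.getVert (k + 1), w) = some β) :
    w = W.getVert k ∨ w = W.getVert (k + 2) := by
  have hprev := color_getVert_succ hW (k := k) (by lia)
  have hnext := color_getVert_succ hW hk
  have hne : W.getVert k ≠ W.getVert (k + 2) := fun h => by
    have := hp.getVert_injOn (show k ≤ W.length by lia) (show k + 2 ≤ W.length by lia) h
    lia
  rw [Sym2.eq_swap] at hprev
  have hadjp := (W.adj_getVert_succ (show k < W.length by lia)).symm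
  have hadjn := W.adj_getVert_succ hk
  by_contra! hcon
  have h₁ := hc.2 hadjp hadjn hne
  have h₂ := hc.2 hadj hadjp hcon.1
  have h₃ := hc.2 hadj hadjn hcon.2
  grind

/-- At its first vertex, a maximal bichromatic path uses the only edge having one of the
two colors. -/
theorem IsMaximalBichromaticPath.eq_snd [DecidableEq V] (hc : AcyclicPartialColoring G c)
    {W : G.Walk a b} (hW : IsMaximalBichromaticPath G c α β W) (hadj : G.Adj a w)
    (hw : c s(a, w) = some α ∨ c s(a, w) = some β) : w = W.snd := by
  obtain ⟨hp, hcol, hmax, -⟩ := hW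
  have hmem := hmax w hadj hw
  by_contra hne
  refine hc.2 α β w (Walk.cons hadj.symm (W.takeUntil w hmem))
    ((Walk.cons_isCycle_iff _ _).2 ⟨hp.takeUntil hmem, fun h => hne ?_⟩) ?_
  · rw [Sym2.eq_swap] at h
    exact hp.eq_snd_of_mem_edges (W.edges_takeUntil_subset_edges hmem h)
  · rw [Walk.edges_cons, List.forall_mem_cons, Sym2.eq_swap]
    exact ⟨hw, fun e he => hcol e (W.edges_takeUntil_subset_edges hmem he)⟩

theorem IsMaximalBichromaticPath.reverse {W : G.Walk a b}
    (hW : IsMaximalBichromaticPath G c α β W) :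
    IsMaximalBichromaticPath G c α β W.reverse := by
  obtain ⟨hp, hcol, ha, hb⟩ := hW
  exact ⟨hp.reverse, by simpa using hcol, by simpa using hb, by simpa using ha⟩

/-- A maximal bichromatic path contains every edge at its vertices having one of its colors. -/
theorem IsMaximalBichromaticPath.mk_mem_edges [DecidableEq V] (hc : AcyclicPartialColoring G c)
    (hab : a ≠ b) {W : G.Walk a b} (hW : IsMaximalBichromaticPath G c α β W)
    (hu : u ∈ W.support) (hadj : G.Adj u w)
    (hw : c s(u, w) = some α ∨ c s(u, w) = some β) : s(u, w) ∈ W.edges := by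
  have hnil : ∀ {x y : V} (p : G.Walk x y), x ≠ y → s(x, p.snd) ∈ p.edges := by
    intro x y p hxy
    cases p with
    | nil => exact absurd rfl hxy
    | cons h q => simp
  obtain ⟨k, rfl, hk⟩ := Walk.mem_support_iff_exists_getVert.1 hu
  rcases Nat.eq_zero_or_pos k with rfl | hpos
  · rw [Walk.getVert_zero] at *
    rw [hW.eq_snd hc hadj hw]
    exact hnil W hab
  rcases hk.eq_or_lt with rfl | hlt
  · rw [Walk.getVert_length] at *
    rw [hW.reverse.eq_snd hc hadj hw]
    simpa using hnil W.reverse hab.symm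
  obtain ⟨k, rfl⟩ := Nat.exists_eq_add_of_lt hpos
  simp only [Nat.zero_add] at *
  rw [Walk.mk_mem_edges_iff_exists]
  rcases hc.1.eq_of_color_getVert hW.1 hW.2.1 hlt hadj hw with rfl | rfl
  · exact ⟨k, by lia, Sym2.eq_swap⟩
  · exact ⟨k + 1, hlt, rfl⟩

/-- If a maximal bichromatic path traverses `i` and then `u`, exchanging the colors of `ui` and
`uj` disconnects its ends in the subgraph formed by the two colors. -/
theorem IsMaximalBichromaticPath.not_bichromatic_of_exchange [DecidableEq V]
    (hc : AcyclicPartialColoring G c) (hc' : ProperPartialColoring G c')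
    (hui : G.Adj u i) (huj : G.Adj u j) (hij : i ≠ j) (hia : i ≠ a) (hja : j ≠ a)
    (hi : c' s(u, i) = c s(u, j)) (hj : c' s(u, j) = c s(u, i))
    (hother : ∀ e, e ≠ s(u, i) → e ≠ s(u, j) → c' e = c e)
    {W : G.Walk a b} (hW : IsMaximalBichromaticPath G c α β W)
    {m : ℕ} (hm : m < W.length) (hmi : W.getVert m = i) (hmu : W.getVert (m + 1) = u)
    (W' : G.Walk a b) : ¬ ∀ e ∈ W'.edges, c' e = some α ∨ c' e = some β := by
  obtain ⟨hp, hcol, -, -⟩ := id hW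
  have hinj : ∀ k l, k ≤ W.length → l ≤ W.length → W.getVert k = W.getVert l → k = l :=
    fun k l hk hl h => hp.getVert_injOn hk hl h
  have hne : ∀ k ≤ m, W.getVert k ≠ u := fun k hk h => by
    have := hinj k (m + 1) (by lia) (by lia) (h.trans hmu.symm)
    lia
  have hm0 : m ≠ 0 := by
    rintro rfl
    exact hia (hmi ▸ W.getVert_zero)
  have hmk : ∀ {v w x : V}, v ≠ u → (w ≠ u ∨ v ≠ x) → s(v, w) ≠ s(u, x) := by
    intro v w x h₁ h₂ h
    rw [Sym2.eq_iff] at h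
    tauto
  intro hW'
  have hb : b ∈ {v | ∃ k ≤ m, W.getVert k = v} := by
    refine mem_of_closed W' ?_ hW' ⟨0, Nat.zero_le _, W.getVert_zero⟩
    rintro _ w hadj hw ⟨k, hk, rfl⟩
    have hku := hne k hk
    rcases k with - | k
    · rw [Walk.getVert_zero] at *
      rw [hother _ (hmk hku (.inr hia.symm)) (hmk hku (.inr hja.symm))] at hw
      exact ⟨1, by lia, (hW.eq_snd hc hadj hw).symm⟩
    have hprev := color_getVert_succ hcol (k := k) (by lia)
    have hnext := color_getVert_succ hcol (k := k + 1) (by lia)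
    have hadjp := (W.adj_getVert_succ (show k < W.length by lia)).symm
    have hadjn := W.adj_getVert_succ (show k + 1 < W.length by lia)
    have hpu := hne k (by lia)
    have hpn : W.getVert k ≠ W.getVert (k + 2) := fun h => by
      have := hinj _ _ (by lia) (by lia) h
      lia
    rw [Sym2.eq_swap] at hprev
    have hcpn := hc.1.2 hadjp hadjn hpn
    have hprev' : c' s(W.getVert (k + 1), W.getVert k) = c s(W.getVert (k + 1), W.getVert k) :=
      hother _ (hmk hku (.inl hpu)) (hmk hku (.inl hpu))
    by_cases hwu : w = u
    · subst hwu
      have hcur := hc'.2 hadj hadjp hpu.symm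
      by_cases hkm : k + 1 = m
      · rw [hkm, hmi] at hw hcur hprev hprev' hnext hcpn
        rw [hmu, Sym2.eq_swap] at hnext hcpn
        rw [Sym2.eq_swap (a := i) (b := w), hi] at hw hcur
        have huij := hc.1.2 hui huj hij
        grind
      have hnu := hne (k + 2) (by lia)
      by_cases hvj : W.getVert (k + 1) = j
      · have hcur' := hc'.2 hadj hadjn hnu.symm
        have hnext' := hother _ (hmk hku (.inl hnu)) (hmk hku (.inl hnu))
        grind
      have hvi : W.getVert (k + 1) ≠ i := fun h =>
        hkm (hinj _ _ (by lia) (by lia) (h.trans hmi.symm))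
      rw [hother _ (hmk hku (.inr hvi)) (hmk hku (.inr hvj))] at hw
      rcases hc.1.eq_of_color_getVert hp hcol (by lia) hadj hw with h | h
      · exact absurd h.symm hpu
      · exact absurd h.symm hnu
    · rw [hother _ (hmk hku (.inl hwu)) (hmk hku (.inl hwu))] at hw
      rcases hc.1.eq_of_color_getVert hp hcol (by lia) hadj hw with rfl | rfl
      · exact ⟨k, by lia, rfl⟩
      · refine ⟨k + 2, ?_, rfl⟩
        by_contra hkm
        obtain rfl : k + 1 = m := by lia
        exact hwu hmu
  obtain ⟨k, hk, hkb⟩ := hb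
  have := hinj k W.length (by lia) le_rfl (hkb.trans W.getVert_length.symm)
  lia

theorem IsMaximalBichromaticPath.not_bichromatic_of_exchange_of_color [DecidableEq V]
    (hc : AcyclicPartialColoring G c) (hc' : ProperPartialColoring G c') (hab : a ≠ b)
    (hui : G.Adj u i) (huj : G.Adj u j) (hij : i ≠ j)
    (hia : i ≠ a) (hib : i ≠ b) (hja : j ≠ a) (hjb : j ≠ b)
    (hi : c' s(u, i) = c s(u, j)) (hj : c' s(u, j) = c s(u, i))
    (hother : ∀ e, e ≠ s(u, i) → e ≠ s(u, j) → c' e = c e)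
    {W : G.Walk a b} (hW : IsMaximalBichromaticPath G c α β W) (hu : u ∈ W.support)
    (hcolor : c s(u, i) = some α ∨ c s(u, i) = some β)
    (W' : G.Walk a b) : ¬ ∀ e ∈ W'.edges, c' e = some α ∨ c' e = some β := by
  have hmem := hW.mk_mem_edges hc hab hu hui hcolor
  obtain ⟨k, hk, he⟩ := W.mk_mem_edges_iff_exists.1 hmem
  obtain ⟨hku, hki⟩ | ⟨hki, hku⟩ := Sym2.eq_iff.1 he
  · have := hW.reverse.not_bichromatic_of_exchange hc hc' hui huj hij hib hjb hi hj hother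
      (m := W.length - (k + 1)) (by rw [Walk.length_reverse]; lia)
      (by rw [Walk.getVert_reverse, ← hki]; congr 1; lia)
      (by rw [Walk.getVert_reverse, ← hku]; congr 1; lia) W'.reverse
    simpa using this
  · exact hW.not_bichromatic_of_exchange hc hc' hui huj hij hia hja hi hj hother hk
      hki hku W'

end BichromaticPath

/-- Lemma 1: if there is a `(λ,ξ,ab)`-critical path through `u` with respect
to a valid partial coloring `c`, with `{λ,ξ} ∩ {c(u,i),c(u,j)} ≠ ∅` and
`{i,j} ∩ {a,b} = ∅`, and the color exchange on the edges `ui`, `uj` yields a proper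
coloring `c'`, then there is no `(λ,ξ,ab)`-critical path with respect to `c'`. -/
theorem colorExchange_breaks_criticalPath {V : Type*} [DecidableEq V]
    (G : SimpleGraph V) (c : Sym2 V → Option ℕ) (hc : AcyclicPartialColoring G c)
    (u i j a b : V) (hui : G.Adj u i) (huj : G.Adj u j) (hab : G.Adj a b) (hij : i ≠ j)
    (hci : (c s(u, i)).isSome) (hcj : (c s(u, j)).isSome)
    (lam ξ : ℕ) (hlamξ : lam ≠ ξ)
    (hmeet : c s(u, i) = some lam ∨ c s(u, i) = some ξ ∨
             c s(u, j) = some lam ∨ c s(u, j) = some ξ)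
    (hia : i ≠ a) (hib : i ≠ b) (hja : j ≠ a) (hjb : j ≠ b)
    (W : G.Walk a b) (hW : IsCriticalPath G c lam ξ W) (huW : u ∈ W.support)
    (c' : Sym2 V → Option ℕ)
    (hc' : c' = fun e =>
      if e = s(u, i) then c s(u, j) else if e = s(u, j) then c s(u, i) else c e)
    (hproper : ProperPartialColoring G c') :
    ¬ ∃ W' : G.Walk a b, IsCriticalPath G c' lam ξ W' := by
  rintro ⟨W', hW'⟩
  have hcol' := hW'.1.1.2.1
  have hmax := hW.1.1
  have hne : s(u, i) ≠ s(u, j) := fun h => hij (Sym2.congr_right.1 h)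
  have hi : c' s(u, i) = c s(u, j) := by simp [hc']
  have hj : c' s(u, j) = c s(u, i) := by simp [hc', hne.symm]
  have hother : ∀ e, e ≠ s(u, i) → e ≠ s(u, j) → c' e = c e := by
    intro e h₁ h₂
    simp [hc', h₁, h₂]
  rw [← or_assoc] at hmeet
  rcases hmeet with h | h
  · exact hmax.not_bichromatic_of_exchange_of_color hc hproper hab.ne hui huj hij hia hib hja hjb
      hi hj hother huW h W' hcol'
  · exact hmax.not_bichromatic_of_exchange_of_color hc hproper hab.ne huj hui hij.symm hja hjb
      hia hib hj hi (fun e h₁ h₂ => hother e h₂ h₁) huW h W' hcol'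

end AEC
end
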